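/- arXiv:2012.05050 — 2 statements merged into one kernel-verified Lean document; each statement's English description precedes it below -/
import Mathlib

section
/- Let p be an odd prime with 3 | (p-1), let ω ∈ F_p be a primitive third root of unity, and let C be the cyclic code of length 3p over F_p with generator polynomial g(x) = (x-1)^5 (x-ω)^3 (x-ω^2)^2. Then C has dimension 3p - 10 and minimum symbol-pair distance 12; in particular C is an MDS symbol-pair code. -/
open Polynomial

/-- The cyclic code of length `n` over `F` with generator polynomial `g`
(with `g ∣ x^n - 1`), viewed as the set of coefficient vectors `c` whose
associated polynomial is divisible by `g`. -/
def cyclicCode {F : Type*} [Field F] (n : ℕ) (g : Polynomial F) :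
    Set (Fin n → F) :=
  {c | g ∣ ∑ i : Fin n, C (c i) * X ^ (i : ℕ)}

/-- Symbol-pair weight of a vector (indices mod n). -/
def pairWt {F : Type*} [Zero F] [DecidableEq F] {n : ℕ} [NeZero n] (x : Fin n → F) : ℕ :=
  (Finset.univ.filter fun i : Fin n => ¬(x i = 0 ∧ x (i + 1) = 0)).card

section Moments

variable {F : Type*} [Field F] [Fintype F]

/-- The `k`-th power moment of a function on a finite field. -/
def moment (f : F → F) (k : ℕ) : F := ∑ e, f e * e ^ k

lemma sum_mul_eval (f : F → F) (Q : F[X]) {m : ℕ} (hQ : Q.natDegree < m) :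
    ∑ e, f e * Q.eval e = ∑ k ∈ Finset.range m, Q.coeff k * moment f k := by
  simp only [moment, Finset.mul_sum, Polynomial.eval_eq_sum_range' hQ]
  rw [Finset.sum_comm]
  exact Finset.sum_congr rfl fun k _ => Finset.sum_congr rfl fun e _ => by ring

lemma moment_comp_add_one (f : F → F) (k : ℕ) :
    moment (fun e => f (e + 1)) k = ∑ e, f e * (e - 1) ^ k :=
  Fintype.sum_equiv (Equiv.addRight (1 : F)) _ _ fun e => by simp

/-- The vanishing conditions at the three cube roots of unity, for a word split into its three
residue classes. -/
structure RootConditions (ω : F) (f₀ f₁ f₂ : F → F) : Prop where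
  at_one : ∀ k < 5, moment f₀ k + moment f₁ k + moment f₂ k = 0
  at_root : ∀ k < 3, moment f₀ k + ω * moment f₁ k + ω ^ 2 * moment f₂ k = 0
  at_sq : ∀ k < 2, moment f₀ k + ω ^ 2 * moment f₁ k + ω * moment f₂ k = 0

lemma moment_shift_zero (f : F → F) : moment (fun e => f (e + 1)) 0 = moment f 0 := by
  rw [moment_comp_add_one]; simp [moment]

lemma moment_shift_one (f : F → F) :
    moment (fun e => f (e + 1)) 1 = moment f 1 - moment f 0 := by
  rw [moment_comp_add_one]
  simp only [moment, ← Finset.sum_sub_distrib]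
  exact Finset.sum_congr rfl fun e _ => by ring

lemma moment_shift_two (f : F → F) :
    moment (fun e => f (e + 1)) 2 = moment f 2 - 2 * moment f 1 + moment f 0 := by
  rw [moment_comp_add_one]
  simp only [moment, Finset.mul_sum, ← Finset.sum_sub_distrib, ← Finset.sum_add_distrib]
  exact Finset.sum_congr rfl fun e _ => by ring

lemma moment_shift_three (f : F → F) : moment (fun e => f (e + 1)) 3 =
    moment f 3 - 3 * moment f 2 + 3 * moment f 1 - moment f 0 := by
  rw [moment_comp_add_one]
  simp only [moment, Finset.mul_sum, ← Finset.sum_sub_distrib, ← Finset.sum_add_distrib]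
  exact Finset.sum_congr rfl fun e _ => by ring

lemma moment_shift_four (f : F → F) : moment (fun e => f (e + 1)) 4 =
    moment f 4 - 4 * moment f 3 + 6 * moment f 2 - 4 * moment f 1 + moment f 0 := by
  rw [moment_comp_add_one]
  simp only [moment, Finset.mul_sum, ← Finset.sum_sub_distrib, ← Finset.sum_add_distrib]
  exact Finset.sum_congr rfl fun e _ => by ring

lemma RootConditions.rotate {ω : F} (hω : ω ^ 2 + ω + 1 = 0) {f₀ f₁ f₂ : F → F}
    (h : RootConditions ω f₀ f₁ f₂) :
    RootConditions ω (fun e => f₁ (e + 1)) (fun e => f₂ (e + 1)) (fun e => f₀ (e + 1)) := by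
  obtain ⟨h1, h2, h3⟩ := h
  have hω3 : ω ^ 3 = 1 := by linear_combination (ω - 1) * hω
  have a0 := h1 0 (by norm_num)
  have a1 := h1 1 (by norm_num)
  have a2 := h1 2 (by norm_num)
  have a3 := h1 3 (by norm_num)
  have a4 := h1 4 (by norm_num)
  have root : ∀ k < 3, moment f₁ k + ω * moment f₂ k + ω ^ 2 * moment f₀ k = 0 := fun k hk => by
    linear_combination ω ^ 2 * h2 k hk - (moment f₁ k + ω * moment f₂ k) * hω3
  have sq : ∀ k < 2, moment f₁ k + ω ^ 2 * moment f₂ k + ω * moment f₀ k = 0 := fun k hk => by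
    linear_combination ω * h3 k hk - moment f₁ k * hω3
  have b0 := root 0 (by norm_num)
  have b1 := root 1 (by norm_num)
  have b2 := root 2 (by norm_num)
  have c0 := sq 0 (by norm_num)
  have c1 := sq 1 (by norm_num)
  refine ⟨fun k hk => ?_, fun k hk => ?_, fun k hk => ?_⟩ <;> interval_cases k <;>
    simp only [moment_shift_zero, moment_shift_one, moment_shift_two, moment_shift_three,
      moment_shift_four]
  · linear_combination a0
  · linear_combination a1 - a0
  · linear_combination a2 - 2 * a1 + a0
  · linear_combination a3 - 3 * a2 + 3 * a1 - a0
  · linear_combination a4 - 4 * a3 + 6 * a2 - 4 * a1 + a0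
  · linear_combination b0
  · linear_combination b1 - b0
  · linear_combination b2 - 2 * b1 + b0
  · linear_combination c0
  · linear_combination c1 - c0

lemma RootConditions.moment_eq_zero {ω : F} (hω : ω ^ 2 + ω + 1 = 0) (h3 : (3 : F) ≠ 0)
    {f₀ f₁ f₂ : F → F} (h : RootConditions ω f₀ f₁ f₂) {k : ℕ} (hk : k < 2) :
    moment f₀ k = 0 ∧ moment f₁ k = 0 ∧ moment f₂ k = 0 := by
  have e1 := h.at_one k (by omega)
  have e2 := h.at_root k (by omega)
  have e3 := h.at_sq k hk
  have hω3 : ω ^ 3 = 1 := by linear_combination (ω - 1) * hω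
  refine ⟨?_, ?_, ?_⟩ <;> refine (mul_eq_zero.mp ?_).resolve_left h3
  · linear_combination e1 + e2 + e3 - (moment f₁ k + moment f₂ k) * hω
  · linear_combination e1 + ω ^ 2 * e2 + ω * e3 - 2 * moment f₁ k * hω3
      - (moment f₀ k + (1 + ω * (ω - 1)) * moment f₂ k) * hω
  · linear_combination e1 + ω * e2 + ω ^ 2 * e3 - 2 * moment f₂ k * hω3
      - (moment f₀ k + (1 + ω * (ω - 1)) * moment f₁ k) * hω

/-- The second moments of the three classes are proportional to `1, ω, ω ^ 2`. -/
lemma RootConditions.moment_two {ω : F} (hω : ω ^ 2 + ω + 1 = 0) (h1 : ω ≠ 1)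
    {f₀ f₁ f₂ : F → F} (h : RootConditions ω f₀ f₁ f₂) :
    moment f₁ 2 = ω * moment f₀ 2 ∧ moment f₂ 2 = ω ^ 2 * moment f₀ 2 := by
  have e1 := h.at_one 2 (by omega)
  have e2 := h.at_root 2 (by omega)
  have h1' : ω - 1 ≠ 0 := sub_ne_zero.mpr h1
  have hω3 : ω ^ 3 = 1 := by linear_combination (ω - 1) * hω
  have key : moment f₁ 2 = ω * moment f₀ 2 := by
    refine mul_left_cancel₀ h1' ?_
    linear_combination -ω ^ 2 * (e2 - ω ^ 2 * e1)
      - (ω * moment f₀ 2 + (ω - 1) * moment f₁ 2) * hω3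
  refine ⟨key, ?_⟩
  linear_combination e1 - key - moment f₀ 2 * hω

lemma moment_three_of_support {f : F → F} {a b c : F}
    (hs : ∀ e, f e ≠ 0 → e = a ∨ e = b ∨ e = c)
    (h0 : moment f 0 = 0) (h1 : moment f 1 = 0) :
    moment f 3 = (a + b + c) * moment f 2 ∧
    moment f 4 = (a ^ 2 + b ^ 2 + c ^ 2 + a * b + b * c + c * a) * moment f 2 := by
  have hz : ∀ e, f e * ((e - a) * (e - b) * (e - c)) = 0 := fun e => by
    by_cases hf : f e = 0
    · simp [hf]
    · rcases hs e hf with rfl | rfl | rfl <;> simp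
  have e1 : moment f 3 - (a + b + c) * moment f 2 + (a * b + b * c + c * a) * moment f 1
      - a * b * c * moment f 0 = 0 := by
    simp only [moment, Finset.mul_sum, ← Finset.sum_sub_distrib, ← Finset.sum_add_distrib]
    exact Finset.sum_eq_zero fun e _ => by linear_combination hz e
  have e2 : moment f 4 - (a + b + c) * moment f 3 + (a * b + b * c + c * a) * moment f 2
      - a * b * c * moment f 1 = 0 := by
    simp only [moment, Finset.mul_sum, ← Finset.sum_sub_distrib, ← Finset.sum_add_distrib]
    exact Finset.sum_eq_zero fun e _ => by linear_combination e * hz e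
  rw [h0, h1] at e1
  rw [h1] at e2
  exact ⟨by linear_combination e1, by linear_combination e2 + (a + b + c) * e1⟩

lemma moment_four_of_support {f : F → F} {a b c d : F}
    (hs : ∀ e, f e ≠ 0 → e = a ∨ e = b ∨ e = c ∨ e = d)
    (h0 : moment f 0 = 0) (h1 : moment f 1 = 0) :
    moment f 4 - (a + b + c + d) * moment f 3 +
      (a * b + a * c + a * d + b * c + b * d + c * d) * moment f 2 = 0 := by
  have hz : ∀ e, f e * ((e - a) * (e - b) * (e - c) * (e - d)) = 0 := fun e => by
    by_cases hf : f e = 0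
    · simp [hf]
    · rcases hs e hf with rfl | rfl | rfl | rfl <;> simp
  have e1 : moment f 4 - (a + b + c + d) * moment f 3 +
      (a * b + a * c + a * d + b * c + b * d + c * d) * moment f 2
      - (a * b * c + a * b * d + a * c * d + b * c * d) * moment f 1
      + a * b * c * d * moment f 0 = 0 := by
    simp only [moment, Finset.mul_sum, ← Finset.sum_sub_distrib, ← Finset.sum_add_distrib]
    exact Finset.sum_eq_zero fun e _ => by linear_combination hz e
  rw [h0, h1] at e1
  linear_combination e1

variable [DecidableEq F]

/-- The number of points at which a function does not vanish. -/
def wt (f : F → F) : ℕ := (Finset.univ.filter fun e => f e ≠ 0).card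

/-- The number of positions `e` such that `f e` or `g (e + 1)` is nonzero. -/
def linkWt (f g : F → F) : ℕ := (Finset.univ.filter fun e => f e ≠ 0 ∨ g (e + 1) ≠ 0).card

lemma eq_zero_of_wt_le {f : F → F} {m : ℕ} (hw : wt f ≤ m) (h : ∀ k < m, moment f k = 0) :
    f = 0 := by
  by_contra hf
  obtain ⟨a, ha⟩ := Function.ne_iff.mp hf
  have ha' : f a ≠ 0 := ha
  set s := Finset.univ.filter fun e => f e ≠ 0 with hs
  have has : a ∈ s := by simp [hs, ha']
  set Q : F[X] := ∏ b ∈ s.erase a, (X - C b) with hQ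
  have hdeg : Q.natDegree < m := by
    rw [hQ, Polynomial.natDegree_finsetProd_X_sub_C_eq_card, Finset.card_erase_of_mem has]
    have := Finset.card_pos.mpr ⟨a, has⟩
    replace hw : s.card ≤ m := hw
    omega
  have h0 := sum_mul_eval f Q hdeg
  rw [Finset.sum_eq_zero (s := Finset.range m)
    fun k hk => by rw [h k (Finset.mem_range.mp hk), mul_zero]] at h0
  rw [Finset.sum_eq_single a] at h0
  · rcases mul_eq_zero.mp h0 with h1 | h1
    · exact ha' h1
    · rw [hQ, Polynomial.eval_prod, Finset.prod_eq_zero_iff] at h1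
      obtain ⟨b, hb, hb'⟩ := h1
      simp only [eval_sub, eval_X, eval_C] at hb'
      exact (Finset.mem_erase.mp hb).1 (sub_eq_zero.mp hb').symm
  · intro b _ hb
    by_cases hfb : f b = 0
    · rw [hfb, zero_mul]
    · rw [hQ, Polynomial.eval_prod, Finset.prod_eq_zero (i := b), mul_zero]
      · simp [hs, hb, hfb]
      · simp
  · simp

lemma le_wt {f : F → F} {m : ℕ} (hf : f ≠ 0) (h : ∀ k < m, moment f k = 0) : m + 1 ≤ wt f := by
  by_contra hlt
  exact hf (eq_zero_of_wt_le (by omega) h)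

lemma wt_eq_zero {f : F → F} : wt f = 0 ↔ f = 0 := by
  simp [wt, Finset.filter_eq_empty_iff, funext_iff]

lemma wt_comp_add (f : F → F) (t : F) : wt (fun e => f (e + t)) = wt f := by
  unfold wt
  refine Finset.card_bij (fun e _ => e + t) ?_ ?_ ?_
  · simp
  · simp
  · intro b hb
    exact ⟨b - t, by simpa using hb, by simp⟩

lemma linkWt_comp_add (f g : F → F) (t : F) :
    linkWt (fun e => f (e + t)) (fun e => g (e + t)) = linkWt f g := by
  unfold linkWt
  refine Finset.card_bij (fun e _ => e + t) ?_ ?_ ?_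
  · intro a ha
    simpa [add_right_comm] using ha
  · simp
  · intro b hb
    refine ⟨b - t, ?_, by simp⟩
    have : b - t + 1 + t = b + 1 := by ring
    simpa [this] using hb

lemma wt_le_linkWt_left (f g : F → F) : wt f ≤ linkWt f g :=
  Finset.card_le_card fun e he => by
    simp only [Finset.mem_filter, Finset.mem_univ, true_and] at he ⊢
    exact Or.inl he

lemma wt_le_linkWt_right (f g : F → F) : wt g ≤ linkWt f g := by
  rw [← wt_comp_add g 1]
  exact Finset.card_le_card fun e he => by
    simp only [Finset.mem_filter, Finset.mem_univ, true_and] at he ⊢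
    exact Or.inr he

lemma ne_zero_of_linkWt_le_left {f g : F → F} (h : linkWt f g ≤ wt f) {e : F}
    (he : g (e + 1) ≠ 0) : f e ≠ 0 := by
  have hsub : (Finset.univ.filter fun e => f e ≠ 0) ⊆
      Finset.univ.filter fun e => f e ≠ 0 ∨ g (e + 1) ≠ 0 :=
    Finset.monotone_filter_right _ fun _ _ => Or.inl
  have := Finset.eq_of_subset_of_card_le hsub h
  have hmem : e ∈ Finset.univ.filter fun e => f e ≠ 0 := by rw [this]; simp [he]
  simpa using hmem

lemma ne_zero_of_linkWt_le_right {f g : F → F} (h : linkWt f g ≤ wt g) {e : F}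
    (he : f e ≠ 0) : g (e + 1) ≠ 0 := by
  have hsub : (Finset.univ.filter fun e => g (e + 1) ≠ 0) ⊆
      Finset.univ.filter fun e => f e ≠ 0 ∨ g (e + 1) ≠ 0 :=
    Finset.monotone_filter_right _ fun _ _ => Or.inr
  rw [← wt_comp_add g 1] at h
  have := Finset.eq_of_subset_of_card_le hsub h
  have hmem : e ∈ Finset.univ.filter fun e => g (e + 1) ≠ 0 := by rw [this]; simp [he]
  simpa using hmem

lemma ne_zero_or_ne_zero_of_linkWt_le {f g : F → F} (h : linkWt f g ≤ wt g + 1) {e e' : F}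
    (hne : e ≠ e') (he : f e ≠ 0) (he' : f e' ≠ 0) : g (e + 1) ≠ 0 ∨ g (e' + 1) ≠ 0 := by
  by_contra! hcon
  have hsub : insert e (insert e' (Finset.univ.filter fun e => g (e + 1) ≠ 0)) ⊆
      Finset.univ.filter fun e => f e ≠ 0 ∨ g (e + 1) ≠ 0 := by
    intro x hx
    simp only [Finset.mem_insert, Finset.mem_filter, Finset.mem_univ, true_and] at hx ⊢
    rcases hx with rfl | rfl | hx
    · exact Or.inl he
    · exact Or.inl he'
    · exact Or.inr hx
  have hcard := Finset.card_le_card hsub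
  rw [Finset.card_insert_of_notMem (by simp [hne, hcon.1]),
    Finset.card_insert_of_notMem (by simp [hcon.2])] at hcard
  rw [← wt_comp_add g 1] at h
  have := hcard.trans h
  exact Nat.not_succ_le_self _ (Nat.succ_le_succ_iff.mp this)

/-- If every cyclic link is tight, the first support is invariant under translation by `3`, so its
size vanishes in the field. -/
lemma wt_cast_eq_zero_of_tight (h3 : (3 : F) ≠ 0) {f₀ f₁ f₂ : F → F}
    (h01 : linkWt f₀ f₁ ≤ wt f₀) (h12 : linkWt f₁ f₂ ≤ wt f₁) (h20 : linkWt f₂ f₀ ≤ wt f₂) :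
    (wt f₀ : F) = 0 := by
  have hinv : ∀ e, f₀ (e + 3) ≠ 0 → f₀ e ≠ 0 := fun e he =>
    ne_zero_of_linkWt_le_left h01 (ne_zero_of_linkWt_le_left h12 (ne_zero_of_linkWt_le_left h20
      (by convert he using 2; ring)))
  set s := Finset.univ.filter fun e => f₀ e ≠ 0 with hs
  have hmap : s.map (Equiv.addRight (-3 : F)).toEmbedding = s := by
    refine Finset.eq_of_subset_of_card_le ?_ (by simp)
    intro x hx
    simp only [Finset.mem_map, Equiv.coe_toEmbedding, Equiv.coe_addRight] at hx
    obtain ⟨y, hy, rfl⟩ := hx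
    simp only [hs, Finset.mem_filter, Finset.mem_univ, true_and] at hy ⊢
    exact hinv _ (by simpa using hy)
  have hsum : ∑ x ∈ s.map (Equiv.addRight (-3 : F)).toEmbedding, x = ∑ x ∈ s, x := by rw [hmap]
  rw [Finset.sum_map] at hsum
  simp only [Equiv.coe_toEmbedding, Equiv.coe_addRight, Finset.sum_add_distrib, Finset.sum_const,
    nsmul_eq_mul] at hsum
  have : (s.card : F) * 3 = 0 := by linear_combination -hsum
  exact (mul_eq_zero.mp this).resolve_right h3

lemma RootConditions.moment_two_ne_zero {ω : F} (hω : ω ^ 2 + ω + 1 = 0) (h3 : (3 : F) ≠ 0)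
    {f₀ f₁ f₂ : F → F} (h : RootConditions ω f₀ f₁ f₂) (hω1 : ω ≠ 1)
    (hw : wt f₀ = 3 ∨ wt f₁ = 3) : moment f₀ 2 ≠ 0 := by
  intro hm
  have key : ∀ f : F → F, wt f = 3 → moment f 0 = 0 → moment f 1 = 0 → moment f 2 = 0 →
      False := fun f hf m0 m1 m2 => by
    have := eq_zero_of_wt_le hf.le fun k hk => by interval_cases k <;> assumption
    rw [wt_eq_zero.mpr this] at hf
    omega
  obtain ⟨a0, b0, -⟩ := h.moment_eq_zero hω h3 (k := 0) (by norm_num)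
  obtain ⟨a1, b1, -⟩ := h.moment_eq_zero hω h3 (k := 1) (by norm_num)
  rcases hw with hw | hw
  · exact key _ hw a0 a1 hm
  · exact key _ hw b0 b1 (by rw [(h.moment_two hω hω1).1, hm, mul_zero])

/-- The case of three translates of one support. -/
lemma RootConditions.not_three_equal {ω : F} (hω : ω ^ 2 + ω + 1 = 0) (hω1 : ω ≠ 1)
    (h3 : (3 : F) ≠ 0) {f₀ f₁ f₂ : F → F} (h : RootConditions ω f₀ f₁ f₂)
    (w0 : wt f₀ = 3) (w1 : wt f₁ = 3) (h01 : linkWt f₀ f₁ = 3) (h12 : linkWt f₁ f₂ = 3) :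
    False := by
  have hM := h.moment_two_ne_zero hω h3 hω1 (Or.inl w0)
  obtain ⟨m1, m2⟩ := h.moment_two hω hω1
  obtain ⟨a0, b0, c0⟩ := h.moment_eq_zero hω h3 (k := 0) (by norm_num)
  obtain ⟨a1, b1, c1⟩ := h.moment_eq_zero hω h3 (k := 1) (by norm_num)
  obtain ⟨a, b, c, -, -, -, hs⟩ := Finset.card_eq_three.mp w0
  have s0 : ∀ e, f₀ e ≠ 0 → e = a ∨ e = b ∨ e = c := fun e he => by
    have : e ∈ Finset.univ.filter fun e => f₀ e ≠ 0 := by simp [he]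
    simpa [hs] using this
  have s1 : ∀ e, f₁ e ≠ 0 → e = a + 1 ∨ e = b + 1 ∨ e = c + 1 := fun e he => by
    have := s0 (e - 1) (ne_zero_of_linkWt_le_left (g := f₁) (by omega) (by simpa using he))
    simpa [sub_eq_iff_eq_add] using this
  have s2 : ∀ e, f₂ e ≠ 0 → e = a + 1 + 1 ∨ e = b + 1 + 1 ∨ e = c + 1 + 1 := fun e he => by
    have := s1 (e - 1) (ne_zero_of_linkWt_le_left (g := f₂) (by omega) (by simpa using he))
    simpa only [sub_eq_iff_eq_add] using this
  have e0 := (moment_three_of_support s0 a0 a1).1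
  have e1 := (moment_three_of_support s1 b0 b1).1
  have e2 := (moment_three_of_support s2 c0 c1).1
  have e := h.at_one 3 (by norm_num)
  rw [e0, e1, e2, m1, m2] at e
  have key : (3 * (2 * ω + 1)) * ω * moment f₀ 2 = 0 := by
    linear_combination e - (a + b + c) * moment f₀ 2 * hω
  have hω0 : ω ≠ 0 := by rintro rfl; simp at hω
  have h21 : 2 * ω + 1 ≠ 0 := fun h21 => h3 (by linear_combination 4 * hω - (2 * ω + 1) * h21)
  simp [hM, hω0, h21, h3] at key

lemma no_translate_overlap {K : Type*} [Field K] {ω a b c d : K} (hω : ω ^ 2 + ω + 1 = 0)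
    (h2 : (2 : K) ≠ 0) (h3 : (3 : K) ≠ 0) (h5 : (5 : K) ≠ 0)
    (hab : a ≠ b) (had : a ≠ d) (hbd : b ≠ d)
    (hd : d = c - 3 + 3 * ω) (hs : a + b - 2 * c = 5 * ω + 1)
    (h : ∀ u v, u ≠ v → (u = a ∨ u = b ∨ u = d) → (v = a ∨ v = b ∨ v = d) →
      (u + 3 = a ∨ u + 3 = b ∨ u + 3 = c) ∨ (v + 3 = a ∨ v + 3 = b ∨ v + 3 = c)) : False := by
  have hω0 : ω ≠ 0 := by rintro rfl; simp at hω
  have hωm1 : ω + 1 ≠ 0 := fun h => by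
    have : (1 : K) = 0 := by linear_combination hω - ω * h
    exact one_ne_zero this
  have hωm2 : ω + 2 ≠ 0 := fun h => h3 (by linear_combination hω - (ω - 1) * h)
  have ha : a + 3 ≠ a := by simpa using h3
  have hb : b + 3 ≠ b := by simpa using h3
  have hdc : d + 3 ≠ c := fun h => mul_ne_zero h3 hω0 (by linear_combination h - hd)
  have h6 : (2 * 3 : K) ≠ 0 := mul_ne_zero h2 h3
  have hA : ∀ u v w, u ≠ v → u ≠ w → u + v - 2 * c = 5 * ω + 1 → w = c - 3 + 3 * ω →
      (u + 3 = v ∨ u + 3 = c) → ¬(w + 3 = u ∨ w + 3 = v) := by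
    rintro u v w - huw hs hd (e | e) (e' | e')
    · exact hωm2 (by linear_combination hs + e - 2 * hd + 2 * e')
    · exact huw (by linear_combination e - e')
    · exact mul_ne_zero h3 hωm1 (by linear_combination e' + e - hd)
    · exact mul_ne_zero h2 hωm2 (by linear_combination -hs + e - e' + hd)
  have hAB : (a + 3 = b ∨ a + 3 = c) → ¬(b + 3 = a ∨ b + 3 = c) := by
    rintro (e | e) (e' | e')
    · exact h6 (by linear_combination e + e')
    · exact mul_ne_zero h5 hωm2 (by linear_combination -hs + e + 2 * e')
    · exact mul_ne_zero h5 hωm2 (by linear_combination -hs + e' + 2 * e)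
    · exact hab (by linear_combination e - e')
  have hAD := hA a b d hab had hs hd
  have hBD := hA b a d hab.symm hbd (by linear_combination hs) hd
  have h1 := h a b hab (by simp) (by simp)
  have h2 := h a d had (by simp) (by simp)
  have h3 := h b d hbd (by simp) (by simp)
  simp only [ha, hb, hdc, false_or, or_false] at h1 h2 h3
  rcases h1 with hA' | hB'
  · exact h3.elim (hAB hA') (hAD hA')
  · exact h2.elim (fun hA' => hAB hA' hB') (fun hD => hBD hB' hD.symm)

lemma replaced_element_eq {K : Type*} [Field K] {ω a b c d : K} (hω : ω ^ 2 + ω + 1 = 0)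
    (hω1 : ω ≠ 1)
    (E3 : (a + b + c) + (a + 1 + (b + 1) + (c + 1)) * ω
      + (a + 1 + 1 + (b + 1 + 1) + (d + 1 + 1)) * ω ^ 2 = 0)
    (E4 : (a ^ 2 + b ^ 2 + c ^ 2 + a * b + b * c + c * a) +
      ((a + 1) ^ 2 + (b + 1) ^ 2 + (c + 1) ^ 2 + (a + 1) * (b + 1) + (b + 1) * (c + 1) +
        (c + 1) * (a + 1)) * ω +
      ((a + 1 + 1) ^ 2 + (b + 1 + 1) ^ 2 + (d + 1 + 1) ^ 2 + (a + 1 + 1) * (b + 1 + 1) +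
        (b + 1 + 1) * (d + 1 + 1) + (d + 1 + 1) * (a + 1 + 1)) * ω ^ 2 = 0) :
    d = c - 3 + 3 * ω ∧ a + b - 2 * c = 5 * ω + 1 := by
  have hω3 : ω ^ 3 = 1 := by linear_combination (ω - 1) * hω
  have hd : d = c - 3 + 3 * ω := by
    linear_combination ω * E3 - (d - c + 6) * hω3 - (ω * (a + b + c) + 3) * hω
  refine ⟨hd, ?_⟩
  have h1ω : 1 - ω ^ 2 ≠ 0 := fun h => hω1 (by linear_combination hω3 + ω * h)
  refine mul_left_cancel₀ h1ω ?_
  subst hd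
  linear_combination -E4 + 4 * c * E3 + ((a - c) ^ 2 + (b - c) ^ 2 + (a - c) * (b - c)
    + (a + b - 2 * c) * (3 * ω + 1) + 9 * ω ^ 2 + 2 * ω - 1 - 6 * c ^ 2) * hω

/-- The case of three supports of size three, the first two of which are translates. -/
lemma RootConditions.not_two_equal {ω : F} (hω : ω ^ 2 + ω + 1 = 0) (hω1 : ω ≠ 1)
    (h2 : (2 : F) ≠ 0) (h3 : (3 : F) ≠ 0) (h5 : (5 : F) ≠ 0) {f₀ f₁ f₂ : F → F}
    (h : RootConditions ω f₀ f₁ f₂) (w0 : wt f₀ = 3) (w1 : wt f₁ = 3) (w2 : wt f₂ = 3)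
    (h01 : linkWt f₀ f₁ = 3) (h12 : linkWt f₁ f₂ = 4) (h20 : linkWt f₂ f₀ ≤ 4) : False := by
  have hM := h.moment_two_ne_zero hω h3 hω1 (Or.inl w0)
  obtain ⟨m1, m2⟩ := h.moment_two hω hω1
  obtain ⟨a0, b0, c0⟩ := h.moment_eq_zero hω h3 (k := 0) (by norm_num)
  obtain ⟨a1, b1, c1⟩ := h.moment_eq_zero hω h3 (k := 1) (by norm_num)
  set s := Finset.univ.filter fun e => f₁ (e + 1) ≠ 0 with hs
  set t := Finset.univ.filter fun e => f₂ (e + 1 + 1) ≠ 0 with ht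
  have hsc : s.card = 3 := (wt_comp_add f₁ 1).trans w1
  have htc : t.card = 3 := by
    rw [← w2, ← wt_comp_add f₂ 1, ← wt_comp_add _ 1]; rfl
  have hst : (s ∪ t).card = 4 := by
    rw [hs, ht, ← Finset.filter_or, ← h12, ← linkWt_comp_add f₁ f₂ 1]; rfl
  have hi := Finset.card_union_add_card_inter s t
  have hi2 : (s ∩ t).card = 2 := by omega
  have hd1 := Finset.card_sdiff_add_card_inter s t
  have hd2 := Finset.card_sdiff_add_card_inter t s
  rw [Finset.inter_comm] at hd2
  obtain ⟨a, b, hab, hi3⟩ := Finset.card_eq_two.mp hi2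
  obtain ⟨c, hc⟩ := Finset.card_eq_one.mp (show (s \ t).card = 1 by omega)
  obtain ⟨d, hd⟩ := Finset.card_eq_one.mp (show (t \ s).card = 1 by omega)
  have hmem : ∀ e, e ∈ s ↔ e = a ∨ e = b ∨ e = c := fun e => by
    rw [← Finset.sdiff_union_inter s t, hc, hi3]
    simp only [Finset.mem_union, Finset.mem_singleton, Finset.mem_insert]
    tauto
  have hmet : ∀ e, e ∈ t ↔ e = a ∨ e = b ∨ e = d := fun e => by
    rw [← Finset.sdiff_union_inter t s, hd, Finset.inter_comm, hi3]
    simp only [Finset.mem_union, Finset.mem_singleton, Finset.mem_insert]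
    tauto
  have hds : d ∉ s := (Finset.mem_sdiff.mp (hd ▸ Finset.mem_singleton_self d)).2
  have hct : c ∉ t := (Finset.mem_sdiff.mp (hc ▸ Finset.mem_singleton_self c)).2
  simp only [hmem, not_or] at hds
  simp only [hmet, not_or] at hct
  simp only [hs, Finset.mem_filter, Finset.mem_univ, true_and] at hmem
  simp only [ht, Finset.mem_filter, Finset.mem_univ, true_and] at hmet
  have s0 : ∀ e, f₀ e ≠ 0 → e = a ∨ e = b ∨ e = c := fun e he =>
    (hmem e).mp (ne_zero_of_linkWt_le_right (by omega) he)
  have s1 : ∀ e, f₁ e ≠ 0 → e = a + 1 ∨ e = b + 1 ∨ e = c + 1 := fun e he => by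
    have := (hmem (e - 1)).mp (by simpa using he)
    simpa [sub_eq_iff_eq_add] using this
  have s2 : ∀ e, f₂ e ≠ 0 → e = a + 1 + 1 ∨ e = b + 1 + 1 ∨ e = d + 1 + 1 := fun e he => by
    have := (hmet (e - 1 - 1)).mp (by simpa using he)
    simpa only [sub_eq_iff_eq_add] using this
  obtain ⟨x0, y0⟩ := moment_three_of_support s0 a0 a1
  obtain ⟨x1, y1⟩ := moment_three_of_support s1 b0 b1
  obtain ⟨x2, y2⟩ := moment_three_of_support s2 c0 c1
  have e3 := h.at_one 3 (by norm_num)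
  have e4 := h.at_one 4 (by norm_num)
  rw [x0, x1, x2, m1, m2] at e3
  rw [y0, y1, y2, m1, m2] at e4
  obtain ⟨hd', hs'⟩ := replaced_element_eq (a := a) (b := b) (c := c) (d := d) hω hω1
    (((mul_eq_zero (b := moment f₀ 2)).mp (by linear_combination e3)).resolve_right hM)
    (((mul_eq_zero (b := moment f₀ 2)).mp (by linear_combination e4)).resolve_right hM)
  refine no_translate_overlap hω h2 h3 h5 hab (Ne.symm hds.1) (Ne.symm hds.2.1) hd' hs' ?_
  intro u v huv hu hv
  have := ne_zero_or_ne_zero_of_linkWt_le (f := f₂) (g := f₀) (by omega)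
    (e := u + 1 + 1) (e' := v + 1 + 1) (by simpa using huv) ((hmet u).mpr hu) ((hmet v).mpr hv)
  have h111 : ∀ x : F, x + 1 + 1 + 1 = x + 3 := fun x => by ring
  rw [h111, h111] at this
  exact this.imp (s0 _) (s0 _)

lemma no_four_chain {K : Type*} [Field K] {ω a b c x : K} (hω : ω ^ 2 + ω + 1 = 0)
    (h2 : (2 : K) ≠ 0) (h3 : (3 : K) ≠ 0) (hab : a ≠ b) (hac : a ≠ c) (hbc : b ≠ c)
    (ha : a + 3 = a ∨ a + 3 = b ∨ a + 3 = c ∨ a + 3 = x)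
    (hb : b + 3 = a ∨ b + 3 = b ∨ b + 3 = c ∨ b + 3 = x)
    (hc : c + 3 = a ∨ c + 3 = b ∨ c + 3 = c ∨ c + 3 = x)
    (hP : a * b + b * c + c * a + x * (a + b + c)
      + (a + b + c + x) * ((a + b + c + 3) * ω + (a + b + c + 6) * ω ^ 2)
      - ((a + 1) ^ 2 + (b + 1) ^ 2 + (c + 1) ^ 2 + (a + 1) * (b + 1) + (b + 1) * (c + 1) +
        (c + 1) * (a + 1)) * ω
      - ((a + 1 + 1) ^ 2 + (b + 1 + 1) ^ 2 + (c + 1 + 1) ^ 2 + (a + 1 + 1) * (b + 1 + 1) +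
        (b + 1 + 1) * (c + 1 + 1) + (c + 1 + 1) * (a + 1 + 1)) * ω ^ 2 = 0) : False := by
  have chain : ∀ u v w : K, u + 3 = v → v + 3 = w → w + 3 = x →
      u * v + v * w + w * u + x * (u + v + w)
      + (u + v + w + x) * ((u + v + w + 3) * ω + (u + v + w + 6) * ω ^ 2)
      - ((u + 1) ^ 2 + (v + 1) ^ 2 + (w + 1) ^ 2 + (u + 1) * (v + 1) + (v + 1) * (w + 1) +
        (w + 1) * (u + 1)) * ω
      - ((u + 1 + 1) ^ 2 + (v + 1 + 1) ^ 2 + (w + 1 + 1) ^ 2 + (u + 1 + 1) * (v + 1 + 1) +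
        (v + 1 + 1) * (w + 1 + 1) + (w + 1 + 1) * (u + 1 + 1)) * ω ^ 2 ≠ 0 := by
    rintro u _ _ rfl rfl rfl hP
    refine mul_ne_zero (mul_ne_zero h2 h2) h3 ?_
    linear_combination -hP + ((4 * u + 18) * (3 * u + 15)
      - ((u + 2) ^ 2 + (u + 5) ^ 2 + (u + 8) ^ 2 + (u + 2) * (u + 5) + (u + 5) * (u + 8)
        + (u + 8) * (u + 2))) * hω
  have n1 : ∀ u : K, u + 3 ≠ u := fun u => by simpa using h3
  have n2 : ∀ u v : K, u + 3 = v → v + 3 ≠ u := fun u v e e' =>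
    mul_ne_zero h2 h3 (by linear_combination e + e')
  have n3 : ∀ u v w : K, u + 3 = v → v + 3 = w → w + 3 ≠ u := fun u v w e e' e'' =>
    mul_ne_zero h3 h3 (by linear_combination e + e' + e'')
  have inj : ∀ u v w : K, u + 3 = w → v + 3 = w → u = v := fun u v w e e' =>
    add_right_cancel (e.trans e'.symm)
  rcases ha with ha | ha | ha | ha <;> rcases hb with hb | hb | hb | hb <;>
    rcases hc with hc | hc | hc | hc <;>
    first
    | exact n1 _ ha
    | exact n1 _ hb
    | exact n1 _ hc
    | exact hab (inj _ _ _ ha hb)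
    | exact hac (inj _ _ _ ha hc)
    | exact hbc (inj _ _ _ hb hc)
    | exact n2 _ _ ha hb
    | exact n2 _ _ ha hc
    | exact n2 _ _ hb hc
    | exact n3 _ _ _ ha hb hc
    | exact n3 _ _ _ ha hc hb
    | exact chain _ _ _ ha hb hc (by linear_combination hP)
    | exact chain _ _ _ ha hc hb (by linear_combination hP)
    | exact chain _ _ _ hb ha hc (by linear_combination hP)
    | exact chain _ _ _ hb hc ha (by linear_combination hP)
    | exact chain _ _ _ hc ha hb (by linear_combination hP)
    | exact chain _ _ _ hc hb ha (by linear_combination hP)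

/-- The case of supports of sizes four, three and three. -/
lemma RootConditions.not_four_three_three {ω : F} (hω : ω ^ 2 + ω + 1 = 0) (hω1 : ω ≠ 1)
    (h2 : (2 : F) ≠ 0) (h3 : (3 : F) ≠ 0) {f₀ f₁ f₂ : F → F}
    (h : RootConditions ω f₀ f₁ f₂) (w0 : wt f₀ = 4) (w1 : wt f₁ = 3) (w2 : wt f₂ = 3)
    (h01 : linkWt f₀ f₁ = 4) (h12 : linkWt f₁ f₂ = 3) (h20 : linkWt f₂ f₀ = 4) : False := by
  have hM := h.moment_two_ne_zero hω h3 hω1 (Or.inr w1)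
  obtain ⟨m1, m2⟩ := h.moment_two hω hω1
  obtain ⟨a0, b0, c0⟩ := h.moment_eq_zero hω h3 (k := 0) (by norm_num)
  obtain ⟨a1, b1, c1⟩ := h.moment_eq_zero hω h3 (k := 1) (by norm_num)
  set s := Finset.univ.filter fun e => f₁ (e + 1) ≠ 0 with hs
  set t := Finset.univ.filter fun e => f₀ e ≠ 0 with ht
  have hsc : s.card = 3 := (wt_comp_add f₁ 1).trans w1
  have hst : s ⊆ t := fun e he => by
    simp only [hs, ht, Finset.mem_filter, Finset.mem_univ, true_and] at he ⊢
    exact ne_zero_of_linkWt_le_left (by omega) he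
  have htc : t.card = 4 := w0
  have hd := Finset.card_sdiff_add_card_eq_card hst
  obtain ⟨x, hx⟩ := Finset.card_eq_one.mp (show (t \ s).card = 1 by omega)
  obtain ⟨a, b, c, hab, hac, hbc, habc⟩ := Finset.card_eq_three.mp hsc
  have hmem : ∀ e, f₁ (e + 1) ≠ 0 ↔ e = a ∨ e = b ∨ e = c := fun e => by
    have : e ∈ s ↔ e = a ∨ e = b ∨ e = c := by rw [habc]; simp
    simpa [hs] using this
  have s0 : ∀ e, f₀ e ≠ 0 → e = a ∨ e = b ∨ e = c ∨ e = x := fun e he => by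
    have : e ∈ t := by simp [ht, he]
    rw [← Finset.sdiff_union_of_subset hst, hx, habc] at this
    simp only [Finset.mem_union, Finset.mem_singleton, Finset.mem_insert] at this
    tauto
  have s1 : ∀ e, f₁ e ≠ 0 → e = a + 1 ∨ e = b + 1 ∨ e = c + 1 := fun e he => by
    have := (hmem (e - 1)).mp (by simpa using he)
    simpa [sub_eq_iff_eq_add] using this
  have s2 : ∀ e, f₂ e ≠ 0 → e = a + 1 + 1 ∨ e = b + 1 + 1 ∨ e = c + 1 + 1 := fun e he => by
    have := s1 (e - 1) (ne_zero_of_linkWt_le_left (g := f₂) (by omega) (by simpa using he))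
    simpa only [sub_eq_iff_eq_add] using this
  have h111 : ∀ y : F, y + 1 + 1 + 1 = y + 3 := fun y => by ring
  have hnext : ∀ e, f₁ (e + 1) ≠ 0 → e + 3 = a ∨ e + 3 = b ∨ e + 3 = c ∨ e + 3 = x :=
    fun e he => s0 _ (h111 e ▸ ne_zero_of_linkWt_le_right (f := f₂) (g := f₀) (e := e + 1 + 1) (by omega)
      (ne_zero_of_linkWt_le_right (f := f₁) (g := f₂) (e := e + 1) (by omega) he))
  have y0 := moment_four_of_support s0 a0 a1
  obtain ⟨x1, y1⟩ := moment_three_of_support s1 b0 b1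
  obtain ⟨x2, y2⟩ := moment_three_of_support s2 c0 c1
  have e3 := h.at_one 3 (by norm_num)
  have e4 := h.at_one 4 (by norm_num)
  rw [x1, x2, m1, m2] at e3
  rw [y1, y2, m1, m2] at e4
  exact no_four_chain hω h2 h3 hab hac hbc (hnext a ((hmem a).mpr (by simp)))
    (hnext b ((hmem b).mpr (by simp))) (hnext c ((hmem c).mpr (by simp)))
    (((mul_eq_zero (b := moment f₀ 2)).mp
      (by linear_combination y0 - e4 + (a + b + c + x) * e3)).resolve_right hM)

lemma RootConditions.two_class_bound {ω : F} (hω : ω ^ 2 + ω + 1 = 0) (hω1 : ω ≠ 1)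
    (h3 : (3 : F) ≠ 0) {f₀ f₁ f₂ : F → F} (h : RootConditions ω f₀ f₁ f₂)
    (hz : f₀ = 0 ∨ f₁ = 0 ∨ f₂ = 0) : ∀ f ∈ [f₀, f₁, f₂], f = 0 ∨ 4 ≤ wt f := by
  obtain ⟨a0, b0, c0⟩ := h.moment_eq_zero hω h3 (k := 0) (by norm_num)
  obtain ⟨a1, b1, c1⟩ := h.moment_eq_zero hω h3 (k := 1) (by norm_num)
  obtain ⟨m1, m2⟩ := h.moment_two hω hω1
  have hz0 : moment (0 : F → F) 2 = 0 := by simp [moment]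
  have hω0 : ω ≠ 0 := by rintro rfl; simp at hω
  have hM : moment f₀ 2 = 0 := by
    rcases hz with rfl | rfl | rfl
    · exact hz0
    · simpa [hz0, hω0] using m1.symm
    · simpa [hz0, hω0] using m2.symm
  rw [hM, mul_zero] at m1 m2
  have key : ∀ f : F → F, moment f 0 = 0 → moment f 1 = 0 → moment f 2 = 0 →
      f = 0 ∨ 4 ≤ wt f := fun f _ _ _ => by
    by_cases hf : f = 0
    · exact Or.inl hf
    · exact Or.inr (le_wt hf fun k hk => by interval_cases k <;> assumption)
  simp only [List.mem_cons, List.not_mem_nil, or_false, forall_eq_or_imp, forall_eq]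
  exact ⟨key _ a0 a1 hM, key _ b0 b1 m1, key _ c0 c1 m2⟩

lemma RootConditions.one_class_bound {ω : F} {f₀ f₁ f₂ : F → F}
    (h : RootConditions ω f₀ f₁ f₂) :
    (f₁ = 0 → f₂ = 0 → f₀ = 0 ∨ 6 ≤ wt f₀) ∧ (f₀ = 0 → f₂ = 0 → f₁ = 0 ∨ 6 ≤ wt f₁) ∧
      (f₀ = 0 → f₁ = 0 → f₂ = 0 ∨ 6 ≤ wt f₂) := by
  have hz : ∀ k, moment (0 : F → F) k = 0 := by simp [moment]
  have key : ∀ f : F → F, (∀ k < 5, moment f k = 0) → f = 0 ∨ 6 ≤ wt f := fun f hf => by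
    by_cases hf0 : f = 0
    · exact Or.inl hf0
    · exact Or.inr (le_wt hf0 hf)
  refine ⟨?_, ?_, ?_⟩ <;> rintro rfl rfl <;>
    exact key _ fun k hk => by simpa [hz] using h.at_one k hk

theorem RootConditions.twelve_le {ω : F} (hω : ω ^ 2 + ω + 1 = 0) (hω1 : ω ≠ 1)
    (hchar : ∀ n : ℕ, 0 < n → n < 7 → (n : F) ≠ 0) {f₀ f₁ f₂ : F → F}
    (h : RootConditions ω f₀ f₁ f₂) (hne : f₀ ≠ 0 ∨ f₁ ≠ 0 ∨ f₂ ≠ 0) :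
    12 ≤ linkWt f₀ f₁ + linkWt f₁ f₂ + linkWt f₂ f₀ := by
  have h2 : (2 : F) ≠ 0 := by exact_mod_cast hchar 2 (by norm_num) (by norm_num)
  have h3 : (3 : F) ≠ 0 := by exact_mod_cast hchar 3 (by norm_num) (by norm_num)
  have h5 : (5 : F) ≠ 0 := by exact_mod_cast hchar 5 (by norm_num) (by norm_num)
  have l1 := wt_le_linkWt_left f₀ f₁
  have r1 := wt_le_linkWt_right f₀ f₁
  have l2 := wt_le_linkWt_left f₁ f₂
  have r2 := wt_le_linkWt_right f₁ f₂
  have l3 := wt_le_linkWt_left f₂ f₀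
  have r3 := wt_le_linkWt_right f₂ f₀
  by_cases hz : f₀ = 0 ∨ f₁ = 0 ∨ f₂ = 0
  · have htwo := h.two_class_bound hω hω1 h3 hz
    simp only [List.mem_cons, List.not_mem_nil, or_false, forall_eq_or_imp, forall_eq] at htwo
    obtain ⟨t0, t1, t2⟩ := htwo
    obtain ⟨o0, o1, o2⟩ := h.one_class_bound
    simp only [← wt_eq_zero, ne_eq] at hz hne t0 t1 t2 o0 o1 o2
    omega
  push Not at hz
  obtain ⟨z0, z1, z2⟩ := hz
  obtain ⟨a0, b0, c0⟩ := h.moment_eq_zero hω h3 (k := 0) (by norm_num)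
  obtain ⟨a1, b1, c1⟩ := h.moment_eq_zero hω h3 (k := 1) (by norm_num)
  have g0 : 3 ≤ wt f₀ := le_wt z0 fun k hk => by interval_cases k <;> assumption
  have g1 : 3 ≤ wt f₁ := le_wt z1 fun k hk => by interval_cases k <;> assumption
  have g2 : 3 ≤ wt f₂ := le_wt z2 fun k hk => by interval_cases k <;> assumption
  by_contra hlt
  have hnt : ¬(linkWt f₀ f₁ ≤ wt f₀ ∧ linkWt f₁ f₂ ≤ wt f₁ ∧ linkWt f₂ f₀ ≤ wt f₂) :=
    fun ⟨p, q, r⟩ => hchar _ (by omega) (by omega) (wt_cast_eq_zero_of_tight h3 p q r)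
  have k1 := h.rotate hω
  have k2 := k1.rotate hω
  have N : ∀ {g₀ g₁ g₂ : F → F}, RootConditions ω g₀ g₁ g₂ →
      ¬(wt g₀ = 3 ∧ wt g₁ = 3 ∧ wt g₂ = 3 ∧ linkWt g₀ g₁ = 3 ∧ linkWt g₁ g₂ = 3) ∧
      ¬(wt g₀ = 3 ∧ wt g₁ = 3 ∧ wt g₂ = 3 ∧ linkWt g₀ g₁ = 3 ∧ linkWt g₁ g₂ = 4 ∧
        linkWt g₂ g₀ ≤ 4) ∧
      ¬(wt g₀ = 4 ∧ wt g₁ = 3 ∧ wt g₂ = 3 ∧ linkWt g₀ g₁ = 4 ∧ linkWt g₁ g₂ = 3 ∧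
        linkWt g₂ g₀ = 4) := fun hg =>
    ⟨fun ⟨p, q, _, r, t⟩ => hg.not_three_equal hω hω1 h3 p q r t,
      fun ⟨p, q, r, t, u, v⟩ => hg.not_two_equal hω hω1 h2 h3 h5 p q r t u v,
      fun ⟨p, q, r, t, u, v⟩ => hg.not_four_three_three hω hω1 h2 h3 p q r t u v⟩
  have N0 := N h
  have N1 := N k1
  have N2 := N k2
  have wt_shift (f : F → F) : wt (fun e => f (e + 1 + 1)) = wt f :=
    (wt_comp_add (fun e => f (e + 1)) 1).trans (wt_comp_add f 1)
  have linkWt_shift (f g : F → F) :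
      linkWt (fun e => f (e + 1 + 1)) (fun e => g (e + 1 + 1)) = linkWt f g :=
    (linkWt_comp_add (fun e => f (e + 1)) (fun e => g (e + 1)) 1).trans (linkWt_comp_add f g 1)
  simp only [wt_comp_add, linkWt_comp_add] at N1
  simp only [wt_shift, linkWt_shift] at N2
  omega

end Moments

section RootsOfCodewords

variable {R : Type*} [CommRing R]

lemma X_sub_C_pow_dvd_X_mul_derivative {a : R} {m : ℕ} {f : R[X]}
    (h : (X - C a) ^ (m + 1) ∣ f) : (X - C a) ^ m ∣ X * derivative f :=
  (pow_sub_one_dvd_derivative_of_pow_dvd h).mul_left X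

lemma sum_mul_pow_eq_zero_of_pow_dvd {n : ℕ} {a : R} :
    ∀ {m : ℕ} {c : Fin n → R}, (X - C a) ^ m ∣ ∑ i : Fin n, C (c i) * X ^ (i : ℕ) →
      ∀ k < m, ∑ i : Fin n, c i * a ^ (i : ℕ) * ((i : ℕ) : R) ^ k = 0 := by
  intro m c h k hk
  induction k generalizing m c with
  | zero =>
    have h1 := (dvd_pow_self (X - C a) hk.ne').trans h
    rw [dvd_iff_isRoot] at h1
    simpa [eval_finsetSum] using h1
  | succ k ih =>
    obtain ⟨m, rfl⟩ : ∃ l, m = l + 1 := ⟨m - 1, by omega⟩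
    have h1 := X_sub_C_pow_dvd_X_mul_derivative h
    have h2 : X * derivative (∑ i : Fin n, C (c i) * X ^ (i : ℕ)) =
        ∑ i : Fin n, C (c i * ((i : ℕ) : R)) * X ^ (i : ℕ) := by
      rw [derivative_sum, Finset.mul_sum]
      refine Finset.sum_congr rfl fun i _ => ?_
      rw [derivative_C_mul_X_pow]
      rcases Nat.eq_zero_or_pos (i : ℕ) with h0 | h0
      · simp [h0]
      · rw [mul_left_comm, ← pow_succ', Nat.sub_add_cancel h0]
    rw [h2] at h1
    rw [← ih h1 (by omega)]
    exact Finset.sum_congr rfl fun i _ => by ring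

end RootsOfCodewords

section CyclicCode

variable {F : Type*} [Field F]

lemma coeff_sum_C_mul_X_pow {n : ℕ} (c : Fin n → F) (i : Fin n) :
    (∑ j : Fin n, C (c j) * X ^ (j : ℕ)).coeff i = c i := by
  simp [coeff_C_mul, coeff_X_pow, Fin.val_inj]

lemma sum_C_coeff_mul_X_pow {n : ℕ} {f : F[X]} (hf : f.degree < n) :
    ∑ i : Fin n, C (f.coeff i) * X ^ (i : ℕ) = f :=
  (sum_fin (fun i a => C a * X ^ i) (by simp) hf).trans (sum_C_mul_X_pow_eq f)

/-- A cyclic code with monic generator of degree `d` has dimension `n - d`. -/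
lemma natCard_cyclicCode {n : ℕ} {g : F[X]} (hg : g.Monic) (hn : g.natDegree ≤ n) :
    Nat.card (cyclicCode n g) = Nat.card F ^ (n - g.natDegree) := by
  have hdeg : ∀ q ∈ degreeLT F (n - g.natDegree), (g * q).degree < n := fun q hq => by
    rw [mem_degreeLT] at hq
    rcases eq_or_ne q 0 with rfl | h0
    · simp
    · rw [degree_eq_natDegree h0, Nat.cast_lt] at hq
      rw [degree_eq_natDegree (hg.mul_right_ne_zero h0), Nat.cast_lt, hg.natDegree_mul' h0]
      omega
  let φ : degreeLT F (n - g.natDegree) → cyclicCode n g := fun q =>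
    ⟨fun i => (g * q.1).coeff i, by
      simpa only [cyclicCode, Set.mem_ofPred_eq, sum_C_coeff_mul_X_pow (hdeg q q.2)] using
        dvd_mul_right g q.1⟩
  have hφ : Function.Bijective φ := by
    refine ⟨fun q r hqr => ?_, fun ⟨c, q, hq⟩ => ?_⟩
    · have h : (fun i : Fin n => (g * q.1).coeff i) = fun i : Fin n => (g * r.1).coeff i :=
        congrArg Subtype.val hqr
      refine Subtype.ext (mul_left_cancel₀ hg.ne_zero ?_)
      rw [← sum_C_coeff_mul_X_pow (hdeg q q.2), ← sum_C_coeff_mul_X_pow (hdeg r r.2)]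
      exact Finset.sum_congr rfl fun i _ => by rw [congrFun h i]
    · have hlt : (∑ i : Fin n, C (c i) * X ^ (i : ℕ)).degree < (n : WithBot ℕ) :=
        mem_degreeLT.mp (Submodule.sum_mem _ fun (i : Fin n) _ => mem_degreeLT.mpr
          ((degree_C_mul_X_pow_le _ _).trans_lt (Nat.cast_lt.mpr i.2)))
      refine ⟨⟨q, mem_degreeLT.mpr ?_⟩, Subtype.ext (funext fun i => ?_)⟩
      · rcases eq_or_ne q 0 with rfl | h0
        · simp
        · rw [hq, degree_eq_natDegree (hg.mul_right_ne_zero h0), Nat.cast_lt,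
            hg.natDegree_mul' h0] at hlt
          rw [degree_eq_natDegree h0, Nat.cast_lt]
          omega
      · exact (congrArg (fun f => f.coeff i) hq).symm.trans (coeff_sum_C_mul_X_pow c i)
  rw [← Nat.card_eq_of_bijective φ hφ, Nat.card_congr (degreeLTEquiv F _).toEquiv, Nat.card_fun,
    Nat.card_fin]

variable [DecidableEq F]

lemma pairWt_coeff_le {n : ℕ} [NeZero n] (g : F[X]) :
    pairWt (fun i : Fin n => g.coeff i) ≤ g.natDegree + 2 := by
  unfold pairWt
  refine (Finset.card_le_card_of_injOn (t := insert (n - 1) (Finset.range (g.natDegree + 1)))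
    Fin.val ?_ (Fin.val_injective.injOn)).trans ?_
  · intro i hi
    simp only [Finset.coe_filter, Finset.mem_univ, true_and, Set.mem_ofPred_eq] at hi
    simp only [Finset.coe_insert, Set.mem_insert_iff, Finset.coe_range, Set.mem_Iio]
    by_contra! h
    have hlt : (i : ℕ) + 1 < n := by omega
    refine hi ⟨coeff_eq_zero_of_natDegree_lt (by omega), coeff_eq_zero_of_natDegree_lt ?_⟩
    rw [Fin.val_add_one_of_lt' hlt]
    omega
  · exact (Finset.card_insert_le _ _).trans (by simp)

end CyclicCode

section ResidueClasses

variable {p : ℕ} [Fact p.Prime]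

/-- The splitting of the coordinates by their residues modulo `3` and modulo `p`. -/
noncomputable def residueEquiv (h : Nat.Coprime 3 p) : Fin (3 * p) ≃ ZMod 3 × ZMod p :=
  Equiv.ofBijective (fun i => ((i : ℕ), (i : ℕ))) <| by
    rw [Fintype.bijective_iff_injective_and_card]
    refine ⟨fun i j hij => ?_, by simp [ZMod.card]⟩
    simp only [Prod.mk.injEq, ZMod.natCast_eq_natCast_iff] at hij
    exact Fin.ext (((Nat.modEq_and_modEq_iff_modEq_mul h).mp hij).eq_of_lt_of_lt i.2 j.2)

lemma natCast_residueEquiv_symm (h : Nat.Coprime 3 p) (x : ZMod 3 × ZMod p) :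
    (((residueEquiv h).symm x : ℕ) : ZMod 3) = x.1 ∧
      (((residueEquiv h).symm x : ℕ) : ZMod p) = x.2 :=
  Prod.ext_iff.mp ((residueEquiv h).apply_symm_apply x)

lemma residueEquiv_add_one (h : Nat.Coprime 3 p) (i : Fin (3 * p)) :
    residueEquiv h (i + 1) = residueEquiv h i + 1 := by
  have hval : ((i + 1 : Fin (3 * p)) : ℕ) ≡ i + 1 [MOD 3 * p] := by
    rw [Fin.val_add, Fin.val_one', Nat.add_mod_mod]
    exact Nat.mod_modEq _ _
  have h3 := (ZMod.natCast_eq_natCast_iff _ _ _).mpr (hval.of_mul_right p)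
  have hp := (ZMod.natCast_eq_natCast_iff _ _ _).mpr (hval.of_mul_left 3)
  push_cast at h3 hp
  exact Prod.ext h3 hp

/-- The part of a word supported on the coordinates congruent to `j` modulo `3`, indexed by the
residue modulo `p`. -/
noncomputable def residueClass (h : Nat.Coprime 3 p) (c : Fin (3 * p) → ZMod p) (j : ZMod 3) :
    ZMod p → ZMod p :=
  fun e => c ((residueEquiv h).symm (j, e))

lemma sum_eq_moments (h : Nat.Coprime 3 p) (c : Fin (3 * p) → ZMod p) {a : ZMod p}
    (ha : a ^ 3 = 1) (k : ℕ) :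
    ∑ i, c i * a ^ (i : ℕ) * ((i : ℕ) : ZMod p) ^ k = moment (residueClass h c 0) k +
      a * moment (residueClass h c 1) k + a ^ 2 * moment (residueClass h c 2) k := by
  have hpow (x : ZMod 3 × ZMod p) :
      a ^ (((residueEquiv h).symm x : Fin (3 * p)) : ℕ) = a ^ x.1.val := by
    rw [← (natCast_residueEquiv_symm h x).1, ZMod.val_natCast, pow_eq_pow_mod _ ha]
  have hclass (j : ZMod 3) :
      ∑ e, c ((residueEquiv h).symm (j, e)) * a ^ (((residueEquiv h).symm (j, e) : Fin _) : ℕ) *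
        ((((residueEquiv h).symm (j, e) : Fin _) : ℕ) : ZMod p) ^ k =
      a ^ j.val * moment (residueClass h c j) k := by
    rw [moment, Finset.mul_sum]
    refine Finset.sum_congr rfl fun e _ => ?_
    rw [hpow, (natCast_residueEquiv_symm h _).2, residueClass]
    ring
  rw [← (residueEquiv h).symm.sum_comp, Fintype.sum_prod_type]
  simp only [hclass]
  refine (Fin.sum_univ_three (fun j : ZMod 3 => _)).trans ?_
  change a ^ 0 * moment (residueClass h c 0) k + a ^ 1 * moment (residueClass h c 1) k +
    a ^ 2 * moment (residueClass h c 2) k = _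
  ring

lemma pairWt_eq_sum_linkWt (h : Nat.Coprime 3 p) (c : Fin (3 * p) → ZMod p) :
    pairWt c = linkWt (residueClass h c 0) (residueClass h c 1) +
      linkWt (residueClass h c 1) (residueClass h c 2) +
      linkWt (residueClass h c 2) (residueClass h c 0) := by
  have hsymm (j : ZMod 3) (e : ZMod p) : (residueEquiv h).symm (j, e) + 1 =
      (residueEquiv h).symm (j + 1, e + 1) := by
    rw [Equiv.eq_symm_apply, residueEquiv_add_one, Equiv.apply_symm_apply]; rfl
  have hclass (j : ZMod 3) : (∑ e, if ¬(c ((residueEquiv h).symm (j, e)) = 0 ∧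
      c ((residueEquiv h).symm (j, e) + 1) = 0) then 1 else 0) =
      linkWt (residueClass h c j) (residueClass h c (j + 1)) := by
    rw [linkWt, Finset.card_filter]
    exact Finset.sum_congr rfl fun e _ =>
      if_congr (by simp only [residueClass, hsymm, not_and_or, ne_eq]) rfl rfl
  rw [pairWt, Finset.card_filter, ← (residueEquiv h).symm.sum_comp, Fintype.sum_prod_type]
  simp only [hclass]
  exact Fin.sum_univ_three (fun j : ZMod 3 => _)

lemma residueClass_ne_zero (h : Nat.Coprime 3 p) {c : Fin (3 * p) → ZMod p} (hc : c ≠ 0) :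
    residueClass h c 0 ≠ 0 ∨ residueClass h c 1 ≠ 0 ∨ residueClass h c 2 ≠ 0 := by
  by_contra! hzero
  obtain ⟨h0, h1, h2⟩ := hzero
  have hall : ∀ j, residueClass h c j = 0 := fun j => by
    fin_cases j
    exacts [h0, h1, h2]
  refine hc (funext fun i => ?_)
  have := congrFun (hall (residueEquiv h i).1) (residueEquiv h i).2
  simpa [residueClass] using this

lemma rootConditions_residueClass (h : Nat.Coprime 3 p) {ω : ZMod p} (hω3 : ω ^ 3 = 1)
    {c : Fin (3 * p) → ZMod p} (hc : c ∈ cyclicCode (3 * p)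
      ((X - 1) ^ 5 * (X - C ω) ^ 3 * (X - C (ω ^ 2)) ^ 2)) :
    RootConditions ω (residueClass h c 0) (residueClass h c 1) (residueClass h c 2) where
  at_one k hk := by
    have h1 := sum_mul_pow_eq_zero_of_pow_dvd (a := (1 : ZMod p)) (m := 5) (c := c) (by
      rw [C_1]
      exact ((dvd_mul_right _ _).trans (dvd_mul_right _ _)).trans hc) k hk
    rw [sum_eq_moments h c (one_pow 3)] at h1
    simpa using h1
  at_root k hk := by
    rw [← sum_eq_moments h c hω3]
    exact sum_mul_pow_eq_zero_of_pow_dvd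
      (((dvd_mul_left _ _).trans (dvd_mul_right _ _)).trans hc) k hk
  at_sq k hk := by
    have h1 := sum_mul_pow_eq_zero_of_pow_dvd ((dvd_mul_left _ _).trans hc) k hk
    have hsq : (ω ^ 2) ^ 2 = ω := by linear_combination ω * hω3
    rwa [sum_eq_moments h c (by linear_combination (ω ^ 3 + 1) * hω3), hsq] at h1

end ResidueClasses

lemma monic_and_natDegree_generator {R : Type*} [CommRing R] [Nontrivial R] (ω : R) :
    ((X - 1) ^ 5 * (X - C ω) ^ 3 * (X - C (ω ^ 2)) ^ 2).Monic ∧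
      ((X - 1) ^ 5 * (X - C ω) ^ 3 * (X - C (ω ^ 2)) ^ 2).natDegree = 10 := by
  have m1 : ((X - 1 : R[X]) ^ 5).Monic := (monic_X_sub_C 1).pow 5
  have m2 : ((X - C ω) ^ 3).Monic := (monic_X_sub_C ω).pow 3
  have m3 : ((X - C (ω ^ 2)) ^ 2).Monic := (monic_X_sub_C _).pow 2
  have d1 : (X - 1 : R[X]).natDegree = 1 := natDegree_X_sub_C 1
  refine ⟨(m1.mul m2).mul m3, ?_⟩
  rw [(m1.mul m2).natDegree_mul m3, m1.natDegree_mul m2, (monic_X_sub_C ω).natDegree_pow,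
    (monic_X_sub_C (ω ^ 2)).natDegree_pow,
    (show (X - 1 : R[X]).Monic from monic_X_sub_C 1).natDegree_pow, d1, natDegree_X_sub_C,
    natDegree_X_sub_C]

theorem stmt11 (p : ℕ) [Fact p.Prime] (hodd : Odd p) (h3 : 3 ∣ p - 1)
    (ω : ZMod p) (hω3 : ω ^ 3 = 1) (hω1 : ω ≠ 1) :
    Nat.card (cyclicCode (3 * p)
        ((X - 1) ^ 5 * (X - C ω) ^ 3 * (X - C (ω ^ 2)) ^ 2)) = p ^ (3 * p - 10) ∧
    IsLeast {w : ℕ | ∃ c ∈ cyclicCode (3 * p)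
        ((X - 1) ^ 5 * (X - C ω) ^ 3 * (X - C (ω ^ 2)) ^ 2),
      c ≠ 0 ∧ pairWt c = w} 12 ∧
    Nat.card (cyclicCode (3 * p)
        ((X - 1) ^ 5 * (X - C ω) ^ 3 * (X - C (ω ^ 2)) ^ 2)) = p ^ (3 * p - 12 + 2) := by
  have hp : p.Prime := Fact.out
  have hp7 : 7 ≤ p := by
    have h2 := hp.two_le
    obtain ⟨r, hr⟩ := hodd
    by_contra hlt
    have : p = 3 ∨ p = 5 := by omega
    omega
  have hcop : Nat.Coprime 3 p := (Nat.coprime_primes Nat.prime_three hp).mpr (by omega)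
  have hω : ω ^ 2 + ω + 1 = 0 :=
    (mul_eq_zero.mp (by linear_combination hω3 : (ω - 1) * (ω ^ 2 + ω + 1) = 0)).resolve_left
      (sub_ne_zero.mpr hω1)
  have hchar : ∀ n : ℕ, 0 < n → n < 7 → (n : ZMod p) ≠ 0 := fun n h0 h7 h => by
    have := Nat.le_of_dvd h0 ((ZMod.natCast_eq_zero_iff n p).mp h)
    omega
  have hlow : ∀ c ∈ cyclicCode (3 * p) ((X - 1) ^ 5 * (X - C ω) ^ 3 * (X - C (ω ^ 2)) ^ 2),
      c ≠ 0 → 12 ≤ pairWt c := fun c hc h0 => by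
    rw [pairWt_eq_sum_linkWt hcop]
    exact (rootConditions_residueClass hcop hω3 hc).twelve_le hω hω1 hchar
      (residueClass_ne_zero hcop h0)
  obtain ⟨hmonic, hdeg⟩ := monic_and_natDegree_generator ω
  have hcard := natCard_cyclicCode (n := 3 * p) hmonic (by omega)
  rw [hdeg, Nat.card_zmod] at hcard
  refine ⟨hcard, ⟨?_, fun w ⟨c, hc, h0, hw⟩ => hw ▸ hlow c hc h0⟩, ?_⟩
  · have hmem : (fun i : Fin (3 * p) =>
        ((X - 1) ^ 5 * (X - C ω) ^ 3 * (X - C (ω ^ 2)) ^ 2).coeff i) ∈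
          cyclicCode (3 * p) ((X - 1) ^ 5 * (X - C ω) ^ 3 * (X - C (ω ^ 2)) ^ 2) := by
      rw [cyclicCode, Set.mem_ofPred_eq, sum_C_coeff_mul_X_pow]
      rw [degree_eq_natDegree hmonic.ne_zero, hdeg]
      exact_mod_cast (by omega : 10 < 3 * p)
    have hne : (fun i : Fin (3 * p) =>
        ((X - 1) ^ 5 * (X - C ω) ^ 3 * (X - C (ω ^ 2)) ^ 2).coeff i) ≠ 0 := fun h => by
      have h10 := congrFun h ⟨10, by omega⟩
      have hlead := hmonic.coeff_natDegree
      rw [hdeg] at hlead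
      exact one_ne_zero (hlead.symm.trans h10)
    refine ⟨_, hmem, hne, le_antisymm ?_ (hlow _ hmem hne)⟩
    exact (pairWt_coeff_le _).trans_eq (by rw [hdeg])
  · rw [hcard]
    congr 1
    omega
end

section
/- Let p be an odd prime with 3 | (p-1), let ω ∈ F_p be a primitive third root of unity, and let C be the cyclic code of length 3p over F_p with generator polynomial g(x) = (x-1)^4 (x-ω)^3 (x-ω^2)^2. Then C has dimension 3p - 9, minimum Hamming distance 5, and minimum symbol-pair distance 10; in particular C is an almost MDS (AMDS) symbol-pair code, i.e., d_p = n - k + 1. -/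
open Polynomial

/-- Hamming weight of a vector. -/
def hammingWt {F : Type*} [Zero F] [DecidableEq F] {n : ℕ} (x : Fin n → F) : ℕ :=
  (Finset.univ.filter fun i => x i ≠ 0).card

/-- The polynomial with coefficient vector `c`. -/
noncomputable def vecPoly {F : Type*} [Field F] {n : ℕ} (c : Fin n → F) : Polynomial F :=
  ∑ i : Fin n, C (c i) * X ^ (i : ℕ)

theorem coeff_vecPoly {F : Type*} [Field F] {n : ℕ} (c : Fin n → F) (i : Fin n) :
    (vecPoly c).coeff i = c i := by
  simp [vecPoly, coeff_X_pow, Fin.val_inj]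

theorem vecPoly_mem_degreeLT {F : Type*} [Field F] {n : ℕ} (c : Fin n → F) :
    vecPoly c ∈ degreeLT F n :=
  Submodule.sum_mem _ fun i _ => mem_degreeLT.2 <|
    (degree_C_mul_X_pow_le _ _).trans_lt (by exact_mod_cast i.2)

theorem vecPoly_coeff {F : Type*} [Field F] {n : ℕ} {f : Polynomial F} (hf : f.degree < n) :
    vecPoly (fun i : Fin n => f.coeff i) = f := by
  by_cases h : f = 0
  · simp [h, vecPoly]
  · rw [vecPoly, Fin.sum_univ_eq_sum_range (fun i => C (f.coeff i) * X ^ i)]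
    exact (as_sum_range_C_mul_X_pow' f ((natDegree_lt_iff_degree_lt h).2 hf)).symm

theorem card_cyclicCode {F : Type*} [Field F] [Finite F] (n : ℕ) (g : Polynomial F)
    (hg : g.Monic) (hn : g.natDegree ≤ n) :
    Nat.card (cyclicCode n g) = Nat.card F ^ (n - g.natDegree) := by
  have hdeg (q : Polynomial F) (hq : q.degree < (n - g.natDegree : ℕ)) : (g * q).degree < n := by
    by_cases h0 : q = 0
    · simp [h0]
    have := (natDegree_lt_iff_degree_lt h0).2 hq
    rw [← natDegree_lt_iff_degree_lt (mul_ne_zero hg.ne_zero h0), hg.natDegree_mul' h0]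
    omega
  let φ : degreeLT F (n - g.natDegree) → cyclicCode n g := fun q =>
    ⟨fun i => (g * q.1).coeff i, by
      change g ∣ vecPoly _
      rw [vecPoly_coeff (hdeg _ (mem_degreeLT.1 q.2))]
      exact dvd_mul_right _ _⟩
  have hφ : Function.Bijective φ := by
    constructor
    · intro q r h
      have h' := congrArg (fun c => vecPoly c.1) h
      simp only [φ] at h'
      rw [vecPoly_coeff (hdeg _ (mem_degreeLT.1 q.2)),
        vecPoly_coeff (hdeg _ (mem_degreeLT.1 r.2))] at h'
      exact Subtype.ext (mul_left_cancel₀ hg.ne_zero h')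
    · rintro ⟨c, q, hq⟩
      change vecPoly c = g * q at hq
      have hc := mem_degreeLT.1 (vecPoly_mem_degreeLT c)
      have hqd : q.degree < (n - g.natDegree : ℕ) := by
        by_cases h0 : q = 0
        · simp [h0]
        rw [hq, ← natDegree_lt_iff_degree_lt (mul_ne_zero hg.ne_zero h0),
          hg.natDegree_mul' h0] at hc
        rw [← natDegree_lt_iff_degree_lt h0]
        omega
      refine ⟨⟨q, mem_degreeLT.2 hqd⟩, Subtype.ext (funext fun i => ?_)⟩
      change (g * q).coeff i = c i
      rw [← hq, coeff_vecPoly]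
  rw [← Nat.card_eq_of_bijective φ hφ, Nat.card_congr (degreeLTEquiv F _).toEquiv, Nat.card_fun]
  simp

/-- The Euler operator `X * d/dX` drops the multiplicity of a root by at most one, so a root of
multiplicity at least `k` annihilates the first `k` weighted power sums of the coefficients. -/
theorem sum_mul_pow_mul_pow_eq_zero {F : Type*} [Field F] {n : ℕ} (a : F) {k t : ℕ} (ht : t < k)
    (c : Fin n → F) (h : (X - C a) ^ k ∣ vecPoly c) :
    ∑ i : Fin n, c i * (i : F) ^ t * a ^ (i : ℕ) = 0 := by
  induction t generalizing k c with
  | zero =>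
    have := dvd_iff_isRoot.1 ((dvd_pow_self _ ht.ne').trans h)
    simpa [vecPoly, eval_finsetSum] using this
  | succ t ih =>
    have hd : (X - C a) ^ (k - 1) ∣ vecPoly (fun i => c i * (i : F)) := by
      have he : vecPoly (fun i => c i * (i : F)) = X * derivative (vecPoly c) := by
        simp only [vecPoly, derivative_sum, Finset.mul_sum, derivative_C_mul_X_pow]
        refine Finset.sum_congr rfl fun i _ => ?_
        rcases Nat.eq_zero_or_pos (i : ℕ) with h0 | h0
        · simp [h0]
        · obtain ⟨m, hm⟩ := Nat.exists_eq_succ_of_ne_zero h0.ne'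
          simp only [hm, Nat.succ_eq_add_one, Nat.add_sub_cancel, pow_succ]
          ring
      rw [he]
      obtain ⟨q, hq⟩ := h
      exact (pow_sub_one_dvd_derivative_of_pow_dvd ⟨q, hq⟩).mul_left _
    rw [← ih (by omega) _ hd]
    exact Finset.sum_congr rfl fun i _ => by ring

theorem lt_card_of_sum_mul_pow_eq_zero {F ι : Type*} [Field F] (T : Finset ι) (v c : ι → F)
    (hv : Set.InjOn v T) (hc : ∀ i ∈ T, c i ≠ 0) (hT : T.Nonempty) (k : ℕ)
    (h : ∀ t < k, ∑ i ∈ T, c i * v i ^ t = 0) : k < T.card := by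
  classical
  by_contra! hk
  obtain ⟨e, he⟩ := hT
  let P : Polynomial F := ∏ j ∈ T.erase e, (X - C (v j))
  have hP : P.natDegree < k := by
    have := Finset.card_erase_lt_of_mem he
    simp only [P, natDegree_prod_of_monic _ _ (fun j _ => monic_X_sub_C (v j)), natDegree_X_sub_C,
      Finset.sum_const, smul_eq_mul, mul_one]
    omega
  have h1 : ∑ i ∈ T, c i * P.eval (v i) = 0 := by
    simp only [eval_eq_sum_range' hP, Finset.mul_sum]
    rw [Finset.sum_comm]
    refine Finset.sum_eq_zero fun t ht => ?_
    rw [← mul_zero (P.coeff t), ← h t (Finset.mem_range.1 ht), Finset.mul_sum]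
    exact Finset.sum_congr rfl fun i _ => by ring
  rw [Finset.sum_eq_single_of_mem e he] at h1
  · refine (mul_ne_zero (hc e he) ?_) h1
    simp only [P, eval_prod, Finset.prod_ne_zero_iff, eval_sub, eval_X, eval_C, sub_ne_zero]
    exact fun j hj hvj => Finset.ne_of_mem_erase hj
      (hv (Finset.mem_of_mem_erase hj) he hvj.symm)
  · intro j hj hje
    simp only [P, eval_prod]
    rw [Finset.prod_eq_zero (Finset.mem_erase.2 ⟨hje, hj⟩) (by simp), mul_zero]

theorem hammingWt_add_card_le_pairWt {F : Type*} [Zero F] [DecidableEq F] {n : ℕ} [NeZero n]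
    (c : Fin n → F) (T : Finset (Fin n)) (hT : ∀ i ∈ T, c i ≠ 0) (hT' : ∀ i ∈ T, c (i - 1) = 0) :
    hammingWt c + T.card ≤ pairWt c := by
  have hinj : Function.Injective fun i : Fin n => i - 1 := sub_left_injective
  rw [← Finset.card_image_of_injective T hinj, hammingWt, pairWt, ← Finset.card_union_of_disjoint]
  · refine Finset.card_le_card fun i hi => ?_
    simp only [Finset.mem_union, Finset.mem_filter_univ, Finset.mem_image] at hi ⊢
    rcases hi with hi | ⟨j, hj, rfl⟩
    · exact fun h => hi h.1
    · rw [sub_add_cancel]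
      exact fun h => hT j hj h.2
  · rw [Finset.disjoint_left]
    simp only [Finset.mem_filter_univ, Finset.mem_image]
    rintro _ hi ⟨j, hj, rfl⟩
    exact hi (hT' j hj)

theorem pairWt_le_two_mul_hammingWt {F : Type*} [Zero F] [DecidableEq F] {n : ℕ} [NeZero n]
    (c : Fin n → F) : pairWt c ≤ 2 * hammingWt c := by
  have hinj : Function.Injective fun i : Fin n => i - 1 := sub_left_injective
  have hsub : (Finset.univ.filter fun i : Fin n => ¬(c i = 0 ∧ c (i + 1) = 0)) ⊆
      (Finset.univ.filter fun i => c i ≠ 0) ∪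
        (Finset.univ.filter fun i => c i ≠ 0).image fun i => i - 1 := by
    intro i hi
    simp only [Finset.mem_union, Finset.mem_filter_univ, Finset.mem_image] at hi ⊢
    by_cases h : c i = 0
    · exact Or.inr ⟨i + 1, fun h' => hi ⟨h, h'⟩, add_sub_cancel_right _ _⟩
    · exact Or.inl h
  have h := (Finset.card_le_card hsub).trans (Finset.card_union_le _ _)
  rw [Finset.card_image_of_injective _ hinj] at h
  simp only [pairWt, hammingWt]
  omega

theorem hammingWt_eq_or_lt_pairWt {F : Type*} [Zero F] [DecidableEq F] {n : ℕ} [NeZero n]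
    (c : Fin n → F) (hc : c ≠ 0) : hammingWt c = n ∨ hammingWt c < pairWt c := by
  by_cases h : ∃ i, c i ≠ 0 ∧ c (i - 1) = 0
  · obtain ⟨i, hi, hi'⟩ := h
    exact Or.inr (by simpa using hammingWt_add_card_le_pairWt c {i} (by simpa) (by simpa))
  · left
    push Not at h
    have hall : ∀ i, c i ≠ 0 := by
      by_contra! h0
      obtain ⟨i, hi⟩ := h0
      have key : ∀ k : ℕ, ∀ j : Fin n, (j : ℕ) = (i + k) % n → c j = 0 := by
        intro k
        induction k with
        | zero =>
          intro j hj
          rw [add_zero, Nat.mod_eq_of_lt i.2] at hj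
          rwa [Fin.ext hj]
        | succ k ih =>
          intro j hj
          by_contra hcj
          refine h j hcj (ih _ ?_)
          have hlt := Nat.mod_lt (i + k) (NeZero.pos n)
          have hj' : j = ⟨(i + k) % n, hlt⟩ + 1 := by
            apply Fin.ext
            rw [hj, Fin.val_add, Fin.val_one', ← Nat.add_mod, ← add_assoc]
          rw [hj', add_sub_cancel_right]
      refine hc (funext fun j => key (j + n - i) j ?_)
      rw [show (i : ℕ) + (j + n - i) = j + n by omega, Nat.add_mod_right, Nat.mod_eq_of_lt j.2]
    simp [hammingWt, hall]

/-- The support of `c` inside the residue class `r` modulo `3`. -/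
def supportMod {F : Type*} [Zero F] [DecidableEq F] {n : ℕ} (c : Fin n → F) (r : ℕ) :
    Finset (Fin n) :=
  Finset.univ.filter fun i => c i ≠ 0 ∧ (i : ℕ) % 3 = r

theorem mem_supportMod {F : Type*} [Zero F] [DecidableEq F] {n : ℕ} {c : Fin n → F} {r : ℕ}
    {i : Fin n} : i ∈ supportMod c r ↔ c i ≠ 0 ∧ (i : ℕ) % 3 = r := by
  simp [supportMod]

theorem sum_eq_sum_supportMod {F M : Type*} [Zero F] [DecidableEq F] [AddCommMonoid M] {n : ℕ}
    (c : Fin n → F) (f : Fin n → M) (hf : ∀ i, c i = 0 → f i = 0) :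
    ∑ i, f i = ∑ i ∈ supportMod c 0, f i + ∑ i ∈ supportMod c 1, f i +
      ∑ i ∈ supportMod c 2, f i := by
  simp only [supportMod, Finset.sum_filter, ← Finset.sum_add_distrib]
  refine Finset.sum_congr rfl fun i _ => ?_
  by_cases hi : c i = 0
  · simp [hi, hf i hi]
  · have : (i : ℕ) % 3 = 0 ∨ (i : ℕ) % 3 = 1 ∨ (i : ℕ) % 3 = 2 := by omega
    rcases this with h | h | h <;> simp [hi, h]

theorem hammingWt_eq_card_supportMod {F : Type*} [Zero F] [DecidableEq F] {n : ℕ}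
    (c : Fin n → F) : hammingWt c =
      (supportMod c 0).card + (supportMod c 1).card + (supportMod c 2).card := by
  have h := sum_eq_sum_supportMod c (fun i => if c i ≠ 0 then 1 else 0) (by simp)
  rw [hammingWt, Finset.card_filter, h]
  simp only [Finset.card_eq_sum_ones]
  congr 1
  · congr 1 <;> exact Finset.sum_congr rfl fun i hi => if_pos (mem_supportMod.1 hi).1
  · exact Finset.sum_congr rfl fun i hi => if_pos (mem_supportMod.1 hi).1

theorem hammingWt_add_card_supportMod_le {F : Type*} [Zero F] [DecidableEq F] {n : ℕ} [NeZero n]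
    (hn : 3 ∣ n) (c : Fin n → F) {r s : ℕ} (hrs : s = (r + 1) % 3) (hr3 : r < 3)
    (hr : (supportMod c r).card = 0) :
    hammingWt c + (supportMod c s).card ≤ pairWt c := by
  refine hammingWt_add_card_le_pairWt c _ (fun i hi => (mem_supportMod.1 hi).1) fun i hi => ?_
  by_contra h
  have hmod : ((i - 1 + 1 : Fin n) : ℕ) % 3 = (((i - 1 : Fin n) : ℕ) + 1) % 3 := by
    rw [Fin.val_add, Fin.val_one', Nat.mod_mod_of_dvd _ hn, Nat.add_mod, Nat.mod_mod_of_dvd _ hn,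
      ← Nat.add_mod]
  rw [sub_add_cancel, (mem_supportMod.1 hi).2] at hmod
  have : i - 1 ∈ supportMod c r := mem_supportMod.2 ⟨h, by omega⟩
  rw [Finset.card_eq_zero.1 hr] at this
  simp at this

theorem injOn_cast_supportMod {p : ℕ} (hp : Nat.Coprime 3 p) (c : Fin (3 * p) → ZMod p) (r : ℕ) :
    Set.InjOn (fun i : Fin (3 * p) => ((i : ℕ) : ZMod p)) (supportMod c r) := by
  intro i hi j hj hij
  have h3 : (i : ℕ) ≡ j [MOD 3] :=
    (mem_supportMod.1 hi).2.trans (mem_supportMod.1 hj).2.symm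
  have hp' : (i : ℕ) ≡ j [MOD p] := (ZMod.natCast_eq_natCast_iff _ _ _).1 hij
  exact Fin.ext (((Nat.modEq_and_modEq_iff_modEq_mul hp).1 ⟨h3, hp'⟩).eq_of_lt_of_lt i.2 j.2)

theorem eq_zero_of_cubeRoot_eqs {F : Type*} [Field F] (h3 : (3 : F) ≠ 0) {ω a b c : F}
    (hω : ω ^ 2 + ω + 1 = 0) (e0 : a + b + c = 0) (e1 : a + ω * b + ω ^ 2 * c = 0)
    (e2 : a + ω ^ 2 * b + (ω ^ 2) ^ 2 * c = 0) : a = 0 ∧ b = 0 ∧ c = 0 := by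
  have hω3 : ω ^ 3 = 1 := by linear_combination (ω - 1) * hω
  refine ⟨?_, ?_, ?_⟩ <;> apply mul_left_cancel₀ h3
  · linear_combination e0 + e1 + e2 - hω * b - (ω ^ 2 - ω + 1) * hω * c
  · linear_combination e0 + ω ^ 2 * e1 + ω * e2 - hω * a - 2 * hω3 * b -
      (ω ^ 3 - ω + 1) * hω * c
  · linear_combination e0 + ω * e1 + ω ^ 2 * e2 - hω * a - (ω ^ 2 - ω + 1) * hω * b -
      (ω ^ 3 + 2) * hω3 * c

theorem eq_mul_of_cubeRoot_eqs {F : Type*} [Field F] {ω a b c : F} (hω1 : ω ≠ 1)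
    (hω : ω ^ 2 + ω + 1 = 0) (e0 : a + b + c = 0) (e1 : a + ω * b + ω ^ 2 * c = 0) :
    a = ω ^ 2 * b ∧ c = ω * b := by
  have ha : a = ω ^ 2 * b := by
    apply mul_left_cancel₀ (sub_ne_zero.2 hω1)
    linear_combination -ω * (ω ^ 2 * e0 - e1) + (ω - 1) * a * hω
  exact ⟨ha, by linear_combination e0 - ha - hω * b⟩

theorem weight_bounds {p : ℕ} [Fact p.Prime] (hp7 : 7 ≤ p)
    {ω : ZMod p} (hω3 : ω ^ 3 = 1) (hω1 : ω ≠ 1) {c : Fin (3 * p) → ZMod p}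
    (hc : c ∈ cyclicCode (3 * p) ((X - 1) ^ 4 * (X - C ω) ^ 3 * (X - C (ω ^ 2)) ^ 2))
    (hc0 : c ≠ 0) : 5 ≤ hammingWt c ∧ 10 ≤ pairWt c := by
  have hpp : p.Prime := Fact.out
  have hcop : Nat.Coprime 3 p := (Nat.coprime_primes Nat.prime_three hpp).2 (by omega)
  have h3 : (3 : ZMod p) ≠ 0 := by
    intro h
    have h' : ((3 : ℕ) : ZMod p) = 0 := by exact_mod_cast h
    exact absurd (Nat.le_of_dvd (by norm_num) ((ZMod.natCast_eq_zero_iff _ _).1 h')) (by omega)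
  have hω : ω ^ 2 + ω + 1 = 0 := by
    apply mul_left_cancel₀ (sub_ne_zero.2 hω1)
    linear_combination hω3
  have hω0 : ω ≠ 0 := by
    rintro rfl
    simp at hω
  change _ ∣ vecPoly c at hc
  let M : ℕ → ℕ → ZMod p := fun r t => ∑ i ∈ supportMod c r, c i * ((i : ℕ) : ZMod p) ^ t
  have hsplit (a : ZMod p) (ha : a ^ 3 = 1) (k t : ℕ) (ht : t < k)
      (hd : (X - C a) ^ k ∣ vecPoly c) : M 0 t + a * M 1 t + a ^ 2 * M 2 t = 0 := by
    have h := sum_mul_pow_mul_pow_eq_zero a ht c hd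
    rw [sum_eq_sum_supportMod c _ (fun i hi => by simp [hi])] at h
    have hr (r : ℕ) : ∑ i ∈ supportMod c r, c i * ((i : ℕ) : ZMod p) ^ t * a ^ (i : ℕ) =
        a ^ r * M r t := by
      simp only [M, Finset.mul_sum]
      refine Finset.sum_congr rfl fun i hi => ?_
      rw [← Nat.div_add_mod (i : ℕ) 3, pow_add, pow_mul, ha, one_pow, (mem_supportMod.1 hi).2,
        ← (mem_supportMod.1 hi).2, Nat.div_add_mod]
      ring
    simpa [hr] using h
  have hE0 (t : ℕ) (ht : t < 4) : M 0 t + M 1 t + M 2 t = 0 := by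
    simpa using hsplit 1 (one_pow 3) 4 t ht
      (by simpa using (dvd_mul_right _ _).trans ((dvd_mul_right _ _).trans hc))
  have hE1 (t : ℕ) (ht : t < 3) : M 0 t + ω * M 1 t + ω ^ 2 * M 2 t = 0 :=
    hsplit ω hω3 3 t ht ((dvd_mul_left _ _).trans ((dvd_mul_right _ _).trans hc))
  have hE2 (t : ℕ) (ht : t < 2) : M 0 t + ω ^ 2 * M 1 t + (ω ^ 2) ^ 2 * M 2 t = 0 :=
    hsplit (ω ^ 2) (by rw [← pow_mul, mul_comm, pow_mul, hω3, one_pow]) 2 t ht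
      ((dvd_mul_left _ _).trans hc)
  have hlow (t : ℕ) (ht : t < 2) : M 0 t = 0 ∧ M 1 t = 0 ∧ M 2 t = 0 :=
    eq_zero_of_cubeRoot_eqs h3 hω (hE0 t (by omega)) (hE1 t (by omega)) (hE2 t ht)
  obtain ⟨hquad0, hquad2⟩ : M 0 2 = ω ^ 2 * M 1 2 ∧ M 2 2 = ω * M 1 2 :=
    eq_mul_of_cubeRoot_eqs hω1 hω (hE0 2 (by omega)) (hE1 2 (by omega))
  have hempty (r t : ℕ) (h : (supportMod c r).card = 0) : M r t = 0 := by
    simp [M, Finset.card_eq_zero.1 h]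
  have hcard (r k : ℕ) (h : ∀ t < k, M r t = 0) :
      (supportMod c r).card = 0 ∨ k < (supportMod c r).card := by
    rcases Finset.eq_empty_or_nonempty (supportMod c r) with he | hne
    · exact Or.inl (by simp [he])
    · exact Or.inr (lt_card_of_sum_mul_pow_eq_zero _ (fun i : Fin (3 * p) => ((i : ℕ) : ZMod p)) c
        (injOn_cast_supportMod hcop c r) (fun i hi => (mem_supportMod.1 hi).1) hne k h)
  have hcard2 (r : ℕ) (hr : r < 3) : (supportMod c r).card = 0 ∨ 2 < (supportMod c r).card := by
    refine hcard r 2 fun t ht => ?_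
    obtain ⟨h0, h1, h2⟩ := hlow t ht
    interval_cases r <;> assumption
  have hcard3 (r s : ℕ) (hr : r < 3) (hs : s < 3) (h : (supportMod c r).card = 0) :
      (supportMod c s).card = 0 ∨ 3 < (supportMod c s).card := by
    have hz := hempty r 2 h
    have hz1 : M 1 2 = 0 := by
      interval_cases r
      · simpa [hquad0, hω0] using hz
      · exact hz
      · simpa [hquad2, hω0] using hz
    refine hcard s 3 fun t ht => ?_
    have ht' : t < 2 ∨ t = 2 := by omega
    rcases ht' with ht | rfl
    · obtain ⟨h0, h1, h2⟩ := hlow t ht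
      interval_cases s <;> assumption
    · interval_cases s
      · rw [hquad0, hz1, mul_zero]
      · exact hz1
      · rw [hquad2, hz1, mul_zero]
  have hcard4 (r s u : ℕ) (hu : u < 3) (hrs : (supportMod c r).card = 0 ∧
      (supportMod c s).card = 0) (hperm : ∀ t, M r t + M s t + M u t = M 0 t + M 1 t + M 2 t) :
      (supportMod c u).card = 0 ∨ 4 < (supportMod c u).card := by
    refine hcard u 4 fun t ht => ?_
    have h := hperm t
    rw [hempty r t hrs.1, hempty s t hrs.2, hE0 t ht] at h
    simpa using h
  have hwt := hammingWt_eq_card_supportMod c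
  have hpos : hammingWt c ≠ 0 := by
    simpa [hammingWt, Finset.filter_eq_empty_iff, funext_iff] using hc0
  have hle : hammingWt c ≤ pairWt c := by
    simpa using hammingWt_add_card_le_pairWt c ∅ (by simp) (by simp)
  have hrun := hammingWt_eq_or_lt_pairWt c hc0
  have hn : 3 ∣ 3 * p := dvd_mul_right _ _
  have p0 := hammingWt_add_card_supportMod_le hn c (r := 0) (s := 1) rfl (by omega)
  have p1 := hammingWt_add_card_supportMod_le hn c (r := 1) (s := 2) rfl (by omega)
  have p2 := hammingWt_add_card_supportMod_le hn c (r := 2) (s := 0) rfl (by omega)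
  have hcases : ((supportMod c 0).card ≠ 0 ∧ (supportMod c 1).card ≠ 0 ∧
      (supportMod c 2).card ≠ 0) ∨ (supportMod c 0).card = 0 ∨ (supportMod c 1).card = 0 ∨
      (supportMod c 2).card = 0 := by omega
  rcases hcases with ⟨n0, n1, n2⟩ | h | h | h
  · have a0 := (hcard2 0 (by omega)).resolve_left n0
    have a1 := (hcard2 1 (by omega)).resolve_left n1
    have a2 := (hcard2 2 (by omega)).resolve_left n2
    omega
  · have b1 := hcard3 0 1 (by omega) (by omega) h
    have b2 := hcard3 0 2 (by omega) (by omega) h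
    have d1 := fun h' => hcard4 0 2 1 (by omega) ⟨h, h'⟩ (fun t => by ring)
    have d2 := fun h' => hcard4 0 1 2 (by omega) ⟨h, h'⟩ (fun t => by ring)
    omega
  · have b0 := hcard3 1 0 (by omega) (by omega) h
    have b2 := hcard3 1 2 (by omega) (by omega) h
    have d0 := fun h' => hcard4 1 2 0 (by omega) ⟨h, h'⟩ (fun t => by ring)
    have d2 := fun h' => hcard4 1 0 2 (by omega) ⟨h, h'⟩ (fun t => by ring)
    omega
  · have b0 := hcard3 2 0 (by omega) (by omega) h
    have b1 := hcard3 2 1 (by omega) (by omega) h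
    have d0 := fun h' => hcard4 2 1 0 (by omega) ⟨h, h'⟩ (fun t => by ring)
    have d1 := fun h' => hcard4 2 0 1 (by omega) ⟨h, h'⟩ (fun t => by ring)
    omega

theorem exists_light_codeword {p : ℕ} [Fact p.Prime] (hp7 : 7 ≤ p)
    {ω : ZMod p} (hω3 : ω ^ 3 = 1) (hω1 : ω ≠ 1) :
    ∃ c ∈ cyclicCode (3 * p) ((X - 1) ^ 4 * (X - C ω) ^ 3 * (X - C (ω ^ 2)) ^ 2),
      c ≠ 0 ∧ hammingWt c ≤ 5 := by
  have hω : ω ^ 2 + ω + 1 = 0 := by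
    apply mul_left_cancel₀ (sub_ne_zero.2 hω1)
    linear_combination hω3
  have hfac : (X ^ 3 - 1 : (ZMod p)[X]) = (X - 1) * (X - C ω) * (X - C (ω ^ 2)) := by
    have h1 : (C ω ^ 2 + C ω + 1 : (ZMod p)[X]) = 0 := by
      simpa using congrArg (C : ZMod p →+* (ZMod p)[X]) hω
    have h2 : (C ω ^ 3 : (ZMod p)[X]) = 1 := by
      simpa using congrArg (C : ZMod p →+* (ZMod p)[X]) hω3
    rw [C_pow]
    linear_combination (X ^ 2 - X) * h1 + (1 - X) * h2
  let f : (ZMod p)[X] := (X ^ 3 - 1) ^ 4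
  have hf : f = C 1 * X ^ 12 + C (-4) * X ^ 9 + C 6 * X ^ 6 + C (-4) * X ^ 3 + C 1 := by
    simp only [f, map_neg, map_one, map_ofNat]
    ring
  have hcoeff (i : ℕ) : f.coeff i = (if i = 12 then 1 else 0) + (if i = 9 then -4 else 0) +
      (if i = 6 then 6 else 0) + (if i = 3 then -4 else 0) + (if i = 0 then 1 else 0) := by
    rw [hf]
    simp only [coeff_add, coeff_C_mul_X_pow, coeff_C]
  have hdeg : f.degree < (3 * p : ℕ) := by
    have : f.degree ≤ 12 := by
      rw [hf]
      compute_degree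
    exact this.trans_lt (by exact_mod_cast (by omega : 12 < 3 * p))
  refine ⟨fun i => f.coeff i, ?_, ?_, ?_⟩
  · change _ ∣ vecPoly _
    rw [vecPoly_coeff hdeg]
    refine ⟨(X - C ω) * (X - C (ω ^ 2)) ^ 2, ?_⟩
    simp only [f, hfac]
    ring
  · intro h
    have := congrFun h ⟨12, by omega⟩
    simp [hcoeff] at this
  · have hsub : (Finset.univ.filter fun i : Fin (3 * p) => f.coeff i ≠ 0).image
        (fun i : Fin (3 * p) => (i : ℕ)) ⊆ {0, 3, 6, 9, 12} := by
      intro i hi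
      obtain ⟨j, hj, rfl⟩ := Finset.mem_image.1 hi
      simp only [Finset.mem_filter_univ, hcoeff] at hj
      simp only [Finset.mem_insert, Finset.mem_singleton]
      by_contra! h
      simp [h] at hj
    have := Finset.card_le_card hsub
    rw [Finset.card_image_of_injective _ Fin.val_injective] at this
    exact this

theorem stmt12 (p : ℕ) [Fact p.Prime] (hodd : Odd p) (h3 : 3 ∣ p - 1)
    (ω : ZMod p) (hω3 : ω ^ 3 = 1) (hω1 : ω ≠ 1) :
    Nat.card (cyclicCode (3 * p)
        ((X - 1) ^ 4 * (X - C ω) ^ 3 * (X - C (ω ^ 2)) ^ 2)) = p ^ (3 * p - 9) ∧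
    IsLeast {w : ℕ | ∃ c ∈ cyclicCode (3 * p)
        ((X - 1) ^ 4 * (X - C ω) ^ 3 * (X - C (ω ^ 2)) ^ 2),
      c ≠ 0 ∧ hammingWt c = w} 5 ∧
    IsLeast {w : ℕ | ∃ c ∈ cyclicCode (3 * p)
        ((X - 1) ^ 4 * (X - C ω) ^ 3 * (X - C (ω ^ 2)) ^ 2),
      c ≠ 0 ∧ pairWt c = w} 10 ∧
    10 = 3 * p - (3 * p - 9) + 1 := by
  have hp7 : 7 ≤ p := by
    have := (Fact.out : p.Prime).two_le
    obtain ⟨m, rfl⟩ := hodd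
    omega
  have hmonic : ((X - 1) ^ 4 * (X - C ω) ^ 3 * (X - C (ω ^ 2)) ^ 2).Monic := by
    monicity!
  have hdeg : ((X - 1) ^ 4 * (X - C ω) ^ 3 * (X - C (ω ^ 2)) ^ 2).natDegree = 9 := by
    compute_degree!
  obtain ⟨c, hc, hc0, hwt⟩ := exists_light_codeword hp7 hω3 hω1
  obtain ⟨hw, hpw⟩ := weight_bounds hp7 hω3 hω1 hc hc0
  have hpair := pairWt_le_two_mul_hammingWt c
  refine ⟨?_, ⟨⟨c, hc, hc0, by omega⟩, ?_⟩, ⟨⟨c, hc, hc0, by omega⟩, ?_⟩, by omega⟩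
  · rw [card_cyclicCode _ _ hmonic (by omega), hdeg, Nat.card_zmod]
  · rintro _ ⟨d, hd, hd0, rfl⟩
    exact (weight_bounds hp7 hω3 hω1 hd hd0).1
  · rintro _ ⟨d, hd, hd0, rfl⟩
    exact (weight_bounds hp7 hω3 hω1 hd hd0).2
end
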